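/- Alternative characterization of extremal subsets via gradient flow: a closed subset E of a finite-dimensional Alexandrov space M is extremal if and only if for every p ∈ M and x ∈ E with p ≠ x, the gradient curve of the distance function dist_p starting at x remains in E for all time. -/

import Mathlib

open Real Metric Set
open scoped ENNReal NNReal

noncomputable section

/-- The comparison angle in the `κ`-plane at the vertex between sides of
lengths `s` and `t`, opposite side of length `d`. -/
def cangleK (κ s t d : ℝ) : ℝ :=
  if 0 < κ then
    Real.arccos ((Real.cos (Real.sqrt κ * d) - Real.cos (Real.sqrt κ * s) * Real.cos (Real.sqrt κ * t)) /
      (Real.sin (Real.sqrt κ * s) * Real.sin (Real.sqrt κ * t)))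
  else if κ < 0 then
    Real.arccos ((Real.cosh (Real.sqrt (-κ) * s) * Real.cosh (Real.sqrt (-κ) * t) -
      Real.cosh (Real.sqrt (-κ) * d)) /
      (Real.sinh (Real.sqrt (-κ) * s) * Real.sinh (Real.sqrt (-κ) * t)))
  else Real.arccos ((s ^ 2 + t ^ 2 - d ^ 2) / (2 * s * t))

/-- The comparison angle `∠̃ q p r` at `p` in the `κ`-plane. -/
def cangle {X : Type*} [MetricSpace X] (κ : ℝ) (q p r : X) : ℝ :=
  cangleK κ (dist p q) (dist p r) (dist q r)

/-- A `(k,δ)`-strainer at `p` (comparison angles taken in the `κ`-plane). -/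
def IsStrainer {X : Type*} [MetricSpace X] (κ : ℝ) {k : ℕ} (a b : Fin k → X) (p : X)
    (δ : ℝ) : Prop :=
  (∀ i, π - δ < cangle κ (a i) p (b i)) ∧
  ∀ i j, i ≠ j →
    π / 2 - δ < cangle κ (a i) p (a j) ∧
    π / 2 - δ < cangle κ (a i) p (b j) ∧
    π / 2 - δ < cangle κ (b i) p (b j)

/-- A `(k,δ)`-strained point. -/
def IsStrainedPt {X : Type*} [MetricSpace X] (κ : ℝ) (k : ℕ) (δ : ℝ) (p : X) : Prop :=
  ∃ a b : Fin k → X, IsStrainer κ a b p δ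

/-- An Alexandrov space of curvature `≥ κ`: complete, geodesic (via midpoints), and the
sum of the three `κ`-comparison angles of any quadruple is at most `2π`. -/
def IsAlexandrov (X : Type*) [MetricSpace X] (κ : ℝ) : Prop :=
  CompleteSpace X ∧
  (∀ x y : X, ∃ z : X, dist x z = dist x y / 2 ∧ dist z y = dist x y / 2) ∧
  ∀ p q r s : X, q ≠ p → r ≠ p → s ≠ p →
    cangle κ q p r + cangle κ r p s + cangle κ s p q ≤ 2 * π

/-- `p` is a critical point of `dist q`. -/
def IsCriticalPt {X : Type*} [MetricSpace X] (κ : ℝ) (q p : X) : Prop :=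
  ∀ x : X, x ≠ p → cangle κ q p x ≤ π / 2

/-- An extremal subset: closed, and every local minimum point `p ∈ E` of `dist q|_E`
with `q ∉ E` is a critical point of `dist q`. -/
def IsExtremal {X : Type*} [MetricSpace X] (κ : ℝ) (E : Set X) : Prop :=
  IsClosed E ∧
  ∀ q ∉ E, ∀ p ∈ E, IsLocalMinOn (fun x => dist q x) E p → IsCriticalPt κ q p

/-- A primitive extremal subset: an extremal subset containing no proper extremal
subset with nonempty relative interior. -/
def IsPrimitiveExtremal {X : Type*} [MetricSpace X] (κ : ℝ) (E : Set X) : Prop :=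
  IsExtremal κ E ∧
  ∀ F : Set X, IsExtremal κ F → F ⊆ E → F ≠ E →
    ∀ x ∈ F, ¬ ∃ r > (0:ℝ), Metric.ball x r ∩ E ⊆ F

/-- `p` is a regular point of `E` of dimension `m`: the tangent cone of `E` at `p`
(with the extrinsic metric) is isometric to `ℝ^m`, expressed through blow-ups:
balls of `E` around `p` at scale `r` are `εr`-approximated by `r`-balls of `ℝ^m`. -/
def IsRegularPt {X : Type*} [MetricSpace X] (E : Set X) (m : ℕ) (p : X) : Prop :=
  ∀ ε > (0:ℝ), ∃ r₀ > (0:ℝ), ∀ r, 0 < r → r < r₀ →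
    ∃ f : X → EuclideanSpace ℝ (Fin m),
      f p = 0 ∧
      (∀ x ∈ E ∩ Metric.closedBall p r, ∀ y ∈ E ∩ Metric.closedBall p r,
        |dist (f x) (f y) - dist x y| ≤ ε * r) ∧
      (∀ v ∈ Metric.closedBall (0 : EuclideanSpace ℝ (Fin m)) r,
        ∃ x ∈ E ∩ Metric.closedBall p r, dist (f x) v ≤ ε * r)

/-- The intrinsic (induced length) extended distance on a subset `E`. -/
def intrinsicEDist {X : Type*} [MetricSpace X] (E : Set X) (x y : X) : ℝ≥0∞ :=
  ⨅ (γ : ℝ → X) (_ : ContinuousOn γ (Set.Icc 0 1)) (_ : γ 0 = x) (_ : γ 1 = y)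
    (_ : ∀ t ∈ Set.Icc (0:ℝ) 1, γ t ∈ E), eVariationOn γ (Set.Icc 0 1)

/-- Diameter of a set with respect to an abstract extended distance. -/
def ediamOn {X : Type*} (ρ : X → X → ℝ≥0∞) (s : Set X) : ℝ≥0∞ :=
  ⨆ x ∈ s, ⨆ y ∈ s, ρ x y

/-- The `m`-dimensional Hausdorff measure of `S` with respect to an abstract
extended distance `ρ`. -/
def hMeas {X : Type*} (ρ : X → X → ℝ≥0∞) (m : ℝ) (S : Set X) : ℝ≥0∞ :=
  ⨆ (ε : ℝ≥0∞) (_ : 0 < ε),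
    ⨅ (t : ℕ → Set X) (_ : S ⊆ ⋃ n, t n) (_ : ∀ n, ediamOn ρ (t n) ≤ ε),
      ∑' n, ediamOn ρ (t n) ^ m

end

noncomputable section

/-- The ascending slope of a function at a point. -/
def ascSlope {X : Type*} [MetricSpace X] (f : X → ℝ) (y : X) : ℝ :=
  max 0 (Filter.limsup (fun z => (f z - f y) / dist z y) (nhdsWithin y {y}ᶜ))

/-- `α` is the gradient curve of `dist p` starting at `x`: it starts at `x`, its
speed is bounded by the ascending slope of `dist p`, and `dist p` grows along it
exactly at rate the squared slope (energy identity for the ascending gradient flow). -/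
def IsGradCurve {X : Type*} [MetricSpace X] (p x : X) (α : ℝ → X) : Prop :=
  α 0 = x ∧ ContinuousOn α (Set.Ici 0) ∧
  (∀ t₁ t₂ : ℝ, 0 ≤ t₁ → t₁ ≤ t₂ →
    dist (α t₁) (α t₂) ≤ ∫ t in t₁..t₂, ascSlope (fun z => dist p z) (α t)) ∧
  (∀ t₁ t₂ : ℝ, 0 ≤ t₁ → t₁ ≤ t₂ →
    dist p (α t₂) - dist p (α t₁) =
      ∫ t in t₁..t₂, (ascSlope (fun z => dist p z) (α t)) ^ 2)

end

section GradientInvariance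

open Filter Topology

/-- The generalized sine of the `κ`-plane. -/
noncomputable def sn (κ u : ℝ) : ℝ :=
  if 0 < κ then sin (√κ * u) / √κ else if κ < 0 then sinh (√(-κ) * u) / √(-κ) else u

/-- The modified distance of the `κ`-plane: the primitive of `sn κ` vanishing at `0`. -/
noncomputable def md (κ u : ℝ) : ℝ :=
  if 0 < κ then (1 - cos (√κ * u)) / κ else if κ < 0 then (cosh (√(-κ) * u) - 1) / (-κ)
  else u ^ 2 / 2

/-- The cosine, before truncation, of the `κ`-comparison angle between sides `s` and `t`
opposite to the side `d`. -/
noncomputable def cosK (κ s t d : ℝ) : ℝ :=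
  (md κ s + (1 - κ * md κ s) * md κ t - md κ d) / (sn κ s * sn κ t)

theorem cangleK_eq (κ s t d : ℝ) : cangleK κ s t d = arccos (cosK κ s t d) := by
  unfold cangleK cosK sn md
  rcases lt_trichotomy κ 0 with h | h | h
  · have h1 : ¬ (0 < κ) := by linarith
    have h2 : 0 < √(-κ) := Real.sqrt_pos.2 (by linarith)
    have h3 : √(-κ) ^ 2 = -κ := Real.sq_sqrt (by linarith)
    simp only [h1, h, if_true, if_false]
    generalize √(-κ) = k at *
    have : κ = - k ^ 2 := by linarith
    subst this
    congr 1
    by_cases ha : sinh (k * s) = 0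
    · simp [ha]
    by_cases hb : sinh (k * t) = 0
    · simp [hb]
    field_simp
    ring
  · subst h
    simp only [lt_irrefl, if_false]
    congr 1
    by_cases ha : s = 0
    · simp [ha]
    by_cases hb : t = 0
    · simp [hb]
    field_simp
    ring
  · have h2 : 0 < √κ := Real.sqrt_pos.2 h
    have h3 : √κ ^ 2 = κ := Real.sq_sqrt h.le
    simp only [h, if_true]
    generalize √κ = k at *
    subst h3
    congr 1
    by_cases ha : sin (k * s) = 0
    · simp [ha]
    by_cases hb : sin (k * t) = 0
    · simp [hb]
    field_simp
    ring

theorem md_add (κ a b : ℝ) :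
    md κ (a + b) = md κ a + (1 - κ * md κ a) * md κ b + sn κ a * sn κ b := by
  unfold sn md
  rcases lt_trichotomy κ 0 with h | h | h
  · have h1 : ¬ (0 < κ) := by linarith
    have h2 : 0 < √(-κ) := Real.sqrt_pos.2 (by linarith)
    have h3 : √(-κ) ^ 2 = -κ := Real.sq_sqrt (by linarith)
    simp only [h1, h, if_true, if_false]
    generalize √(-κ) = k at *
    have : κ = - k ^ 2 := by linarith
    subst this
    rw [mul_add, cosh_add]
    field_simp
    ring
  · subst h
    simp only [lt_irrefl, if_false]
    ring
  · have h2 : 0 < √κ := Real.sqrt_pos.2 h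
    have h3 : √κ ^ 2 = κ := Real.sq_sqrt h.le
    simp only [h, if_true]
    generalize √κ = k at *
    subst h3
    rw [mul_add, cos_add]
    field_simp
    ring

theorem sn_add (κ a b : ℝ) :
    sn κ (a + b) = sn κ a * (1 - κ * md κ b) + (1 - κ * md κ a) * sn κ b := by
  unfold sn md
  rcases lt_trichotomy κ 0 with h | h | h
  · have h1 : ¬ (0 < κ) := by linarith
    have h2 : 0 < √(-κ) := Real.sqrt_pos.2 (by linarith)
    have h3 : √(-κ) ^ 2 = -κ := Real.sq_sqrt (by linarith)
    simp only [h1, h, if_true, if_false]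
    generalize √(-κ) = k at *
    have : κ = - k ^ 2 := by linarith
    subst this
    rw [mul_add, sinh_add]
    field_simp
    ring
  · subst h
    simp only [lt_irrefl, if_false]
    ring
  · have h2 : 0 < √κ := Real.sqrt_pos.2 h
    have h3 : √κ ^ 2 = κ := Real.sq_sqrt h.le
    simp only [h, if_true]
    generalize √κ = k at *
    subst h3
    rw [mul_add, sin_add]
    field_simp
    ring

@[simp] theorem md_zero (κ : ℝ) : md κ 0 = 0 := by simp [md]

@[simp] theorem sn_zero (κ : ℝ) : sn κ 0 = 0 := by simp [sn]

theorem md_neg (κ u : ℝ) : md κ (-u) = md κ u := by simp [md]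

theorem sn_neg (κ u : ℝ) : sn κ (-u) = - sn κ u := by
  unfold sn; split_ifs <;> simp [neg_div]

theorem sn_sq (κ u : ℝ) : sn κ u ^ 2 = md κ u * (2 - κ * md κ u) := by
  have := md_add κ u (-u)
  rw [md_neg, sn_neg, add_neg_cancel, md_zero] at this
  linarith

theorem md_sub (κ a b : ℝ) :
    md κ (a - b) = md κ a + (1 - κ * md κ a) * md κ b - sn κ a * sn κ b := by
  have := md_add κ a (-b)
  rw [md_neg, sn_neg, ← sub_eq_add_neg] at this
  linarith

theorem hasDerivAt_md (κ u : ℝ) : HasDerivAt (md κ) (sn κ u) u := by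
  unfold sn
  have e : md κ = fun u => md κ u := rfl
  rw [e]
  unfold md
  rcases lt_trichotomy κ 0 with h | h | h
  · have h1 : ¬ (0 < κ) := by linarith
    have h2 : 0 < √(-κ) := Real.sqrt_pos.2 (by linarith)
    have h3 : √(-κ) ^ 2 = -κ := Real.sq_sqrt (by linarith)
    simp only [h1, h, if_true, if_false]
    refine (((((hasDerivAt_id u).const_mul (√(-κ))).cosh).sub_const 1).div_const
      (-κ)).congr_deriv ?_
    generalize √(-κ) = k at *
    rw [← h3]
    simp only [id]
    field_simp
  · subst h
    simp only [lt_irrefl, if_false]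
    refine (((hasDerivAt_id u).pow 2).div_const 2).congr_deriv ?_
    simp
  · have h2 : 0 < √κ := Real.sqrt_pos.2 h
    have h3 : √κ ^ 2 = κ := Real.sq_sqrt h.le
    simp only [h, if_true]
    refine (((((hasDerivAt_id u).const_mul (√κ)).cos).const_sub 1).div_const κ).congr_deriv ?_
    generalize √κ = k at *
    subst h3
    simp only [id]
    field_simp

theorem hasDerivAt_sn (κ u : ℝ) : HasDerivAt (sn κ) (1 - κ * md κ u) u := by
  unfold md
  have e : sn κ = fun u => sn κ u := rfl
  rw [e]
  unfold sn
  rcases lt_trichotomy κ 0 with h | h | h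
  · have h1 : ¬ (0 < κ) := by linarith
    have h2 : 0 < √(-κ) := Real.sqrt_pos.2 (by linarith)
    have h4 : κ ≠ 0 := h.ne
    simp only [h1, h, if_true, if_false]
    refine ((((hasDerivAt_id u).const_mul (√(-κ))).sinh).div_const (√(-κ))).congr_deriv ?_
    generalize √(-κ) = k at *
    simp only [id]
    field_simp
    ring
  · subst h
    simp only [lt_irrefl, if_false]
    refine (hasDerivAt_id u).congr_deriv ?_
    simp
  · have h2 : 0 < √κ := Real.sqrt_pos.2 h
    simp only [h, if_true]
    refine ((((hasDerivAt_id u).const_mul (√κ)).sin).div_const (√κ)).congr_deriv ?_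
    generalize √κ = k at *
    simp only [id]
    field_simp
    ring

theorem continuous_md (κ : ℝ) : Continuous (md κ) :=
  continuous_iff_continuousAt.2 fun u => (hasDerivAt_md κ u).continuousAt

theorem continuous_sn (κ : ℝ) : Continuous (sn κ) :=
  continuous_iff_continuousAt.2 fun u => (hasDerivAt_sn κ u).continuousAt

/-- On `[0, R]` the functions `sn κ` and `md κ` are uniformly close to their Euclidean
counterparts. -/
def IsSmallRadius (κ R : ℝ) : Prop :=
  0 < R ∧ ∀ u ∈ Icc 0 R, 1 / 2 ≤ 1 - κ * md κ u ∧ 1 - κ * md κ u ≤ 2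

theorem exists_isSmallRadius (κ : ℝ) : ∃ R, IsSmallRadius κ R := by
  have hc : Continuous fun u => 1 - κ * md κ u :=
    continuous_const.sub (continuous_const.mul (continuous_md κ))
  have h0 : (1 : ℝ) - κ * md κ 0 ∈ Ioo (1 / 2 : ℝ) 2 := by simp; norm_num
  obtain ⟨r, hr, h⟩ := Metric.eventually_nhds_iff.1 (hc.continuousAt.eventually
    (isOpen_Ioo.mem_nhds h0))
  refine ⟨r / 2, by positivity, fun u hu => ?_⟩
  have := h (y := u) (by rw [Real.dist_eq, sub_zero, abs_of_nonneg hu.1]; linarith [hu.2])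
  exact ⟨this.1.le, this.2.le⟩

namespace IsSmallRadius

variable {κ R : ℝ}

theorem sn_bounds (h : IsSmallRadius κ R) {a b : ℝ} (ha : 0 ≤ a) (hab : a ≤ b) (hb : b ≤ R) :
    (b - a) / 2 ≤ sn κ b - sn κ a ∧ sn κ b - sn κ a ≤ 2 * (b - a) := by
  have hd : ∀ x ∈ interior (Icc a b), 1 / 2 ≤ deriv (sn κ) x ∧ deriv (sn κ) x ≤ 2 := by
    intro x hx
    rw [interior_Icc] at hx
    rw [(hasDerivAt_sn κ x).deriv]
    exact h.2 x ⟨by linarith [hx.1], by linarith [hx.2]⟩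
  have hdiff : DifferentiableOn ℝ (sn κ) (interior (Icc a b)) :=
    fun x _ => (hasDerivAt_sn κ x).differentiableAt.differentiableWithinAt
  have h1 := (convex_Icc a b).mul_sub_le_image_sub_of_le_deriv (continuous_sn κ).continuousOn
    hdiff (fun x hx => (hd x hx).1) a (left_mem_Icc.2 hab) b (right_mem_Icc.2 hab) hab
  have h2 := (convex_Icc a b).image_sub_le_mul_sub_of_deriv_le (continuous_sn κ).continuousOn
    hdiff (fun x hx => (hd x hx).2) a (left_mem_Icc.2 hab) b (right_mem_Icc.2 hab) hab
  constructor <;> linarith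

theorem half_le_sn (h : IsSmallRadius κ R) {u : ℝ} (hu : 0 ≤ u) (hR : u ≤ R) : u / 2 ≤ sn κ u := by
  simpa using (h.sn_bounds le_rfl hu hR).1

theorem sn_le (h : IsSmallRadius κ R) {u : ℝ} (hu : 0 ≤ u) (hR : u ≤ R) : sn κ u ≤ 2 * u := by
  simpa using (h.sn_bounds le_rfl hu hR).2

theorem sn_pos (h : IsSmallRadius κ R) {u : ℝ} (hu : 0 < u) (hR : u ≤ R) : 0 < sn κ u := by
  linarith [h.half_le_sn hu.le hR]

theorem md_bounds (h : IsSmallRadius κ R) {a b : ℝ} (ha : 0 ≤ a) (hab : a ≤ b) (hb : b ≤ R) :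
    sn κ a * (b - a) ≤ md κ b - md κ a ∧ md κ b - md κ a ≤ sn κ b * (b - a) := by
  have hd : ∀ x ∈ interior (Icc a b), sn κ a ≤ deriv (md κ) x ∧ deriv (md κ) x ≤ sn κ b := by
    intro x hx
    rw [interior_Icc] at hx
    rw [(hasDerivAt_md κ x).deriv]
    have h1 := (h.sn_bounds ha hx.1.le (by linarith [hx.2])).1
    have h2 := (h.sn_bounds (ha.trans hx.1.le) hx.2.le hb).1
    constructor <;> linarith [hx.1, hx.2]
  have hdiff : DifferentiableOn ℝ (md κ) (interior (Icc a b)) :=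
    fun x _ => (hasDerivAt_md κ x).differentiableAt.differentiableWithinAt
  exact ⟨(convex_Icc a b).mul_sub_le_image_sub_of_le_deriv (continuous_md κ).continuousOn
    hdiff (fun x hx => (hd x hx).1) a (left_mem_Icc.2 hab) b (right_mem_Icc.2 hab) hab,
    (convex_Icc a b).image_sub_le_mul_sub_of_deriv_le (continuous_md κ).continuousOn
    hdiff (fun x hx => (hd x hx).2) a (left_mem_Icc.2 hab) b (right_mem_Icc.2 hab) hab⟩

theorem sn_nonneg (h : IsSmallRadius κ R) {u : ℝ} (hu : 0 ≤ u) (hR : u ≤ R) : 0 ≤ sn κ u := by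
  linarith [h.half_le_sn hu hR]

theorem md_mono (h : IsSmallRadius κ R) {a b : ℝ} (ha : 0 ≤ a) (hab : a ≤ b) (hb : b ≤ R) :
    md κ a ≤ md κ b := by
  have := (h.md_bounds ha hab hb).1
  nlinarith [h.sn_nonneg ha (hab.trans hb)]

theorem md_nonneg (h : IsSmallRadius κ R) {u : ℝ} (hu : 0 ≤ u) (hR : u ≤ R) : 0 ≤ md κ u := by
  simpa using h.md_mono le_rfl hu hR

/-- `md κ` lies above its tangent lines. -/
theorem md_tangent (h : IsSmallRadius κ R) {a x : ℝ} (ha : 0 ≤ a) (haR : a ≤ R) (hx : 0 ≤ x)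
    (hxR : x ≤ R) : md κ a + sn κ a * (x - a) ≤ md κ x := by
  rcases le_total a x with hax | hax
  · linarith [(h.md_bounds ha hax hxR).1]
  · linarith [(h.md_bounds hx hax haR).2]

theorem md_le (h : IsSmallRadius κ R) {u : ℝ} (hu : 0 ≤ u) (hR : u ≤ R) : md κ u ≤ 2 * u ^ 2 := by
  have := (h.md_bounds le_rfl hu hR).2
  simp only [md_zero, sub_zero] at this
  nlinarith [h.sn_le hu hR]

theorem sq_le_md (h : IsSmallRadius κ R) {u : ℝ} (hu : 0 ≤ u) (hR : u ≤ R) :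
    u ^ 2 / 8 ≤ md κ u := by
  have h1 := (h.md_bounds (a := u / 2) (b := u) (by linarith) (by linarith) hR).1
  have h2 := h.half_le_sn (u := u / 2) (by linarith) (by linarith)
  have h3 := h.md_nonneg (u := u / 2) (by linarith) (by linarith)
  nlinarith

/-- If the comparison angle between sides `u`, `t` is at most a right angle, the opposite side
exceeds `u` by at most a quadratic amount in `t`. -/
theorem le_add_of_md_le (h : IsSmallRadius κ R) {A u t : ℝ} (hA : 0 ≤ A) (hAR : A ≤ R)
    (hu : 0 < u) (huR : u ≤ R) (ht : 0 ≤ t) (htR : t ≤ R)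
    (hmd : md κ A ≤ md κ u + (1 - κ * md κ u) * md κ t) : A ≤ u + 8 * t ^ 2 / u := by
  have h1 := h.md_tangent hu.le huR hA hAR
  have h2 := (h.2 u ⟨hu.le, huR⟩).2
  have h3 := h.md_le ht htR
  have h4 := h.md_nonneg ht htR
  have h5 := h.half_le_sn hu.le huR
  by_contra hc
  push Not at hc
  have h6 : 8 * t ^ 2 / u < A - u := by linarith
  rw [div_lt_iff₀ hu] at h6
  have h7 : 0 < A - u := by
    have : 0 ≤ 8 * t ^ 2 / u := by positivity
    linarith
  nlinarith [mul_le_mul_of_nonneg_right h5 h7.le]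

/-- Triangle inequalities give no truncation in the comparison angle. -/
theorem abs_cosK_le (h : IsSmallRadius κ R) {s t d : ℝ} (hs : 0 < s) (ht : 0 < t) (hd : 0 ≤ d)
    (hst : s + t ≤ R) (h1 : d ≤ s + t) (h2 : s ≤ d + t) (h3 : t ≤ d + s) :
    -1 ≤ cosK κ s t d ∧ cosK κ s t d ≤ 1 := by
  have hpos : 0 < sn κ s * sn κ t :=
    mul_pos (h.sn_pos hs (by linarith)) (h.sn_pos ht (by linarith))
  have e1 := md_add κ s t
  have e2 := md_sub κ s t
  have m1 := h.md_mono hd h1 hst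
  have m2 : md κ (s - t) ≤ md κ d := by
    rcases le_total t s with hh | hh
    · exact h.md_mono (by linarith) (by linarith) (by linarith)
    · rw [← md_neg]
      exact h.md_mono (by linarith) (by linarith) (by linarith)
  unfold cosK
  rw [le_div_iff₀ hpos, div_le_iff₀ hpos]
  constructor <;> linarith

end IsSmallRadius

theorem cosK_comm (κ s t d : ℝ) : cosK κ s t d = cosK κ t s d := by
  unfold cosK
  congr 1 <;> ring

theorem add_nonneg_or_of_arccos_add_le {A B : ℝ} (hA : -1 ≤ A) (h : arccos A + arccos B ≤ π) :
    0 ≤ A + B ∨ 1 ≤ A := by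
  by_contra hc
  push Not at hc
  have h1 : arccos (-B) ≤ arccos (min (-B) 1) := antitone_arccos (min_le_left _ _)
  have h2 : A < min (-B) 1 := lt_min (by linarith) hc.2
  have h3 := strictAntiOn_arccos ⟨hA, by linarith⟩ ⟨by linarith, min_le_right _ _⟩ h2
  rw [arccos_neg] at h1
  linarith

section Comparison

variable {X : Type*} [MetricSpace X] {κ R : ℝ}

theorem IsAlexandrov.arccos_add_le (hX : IsAlexandrov X κ) {a b c m : X}
    (hm : dist a m + dist m b = dist a b) (hc : c ≠ m)
    (ha : sn κ (dist m a) ≠ 0) (hb : sn κ (dist m b) ≠ 0) :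
    arccos (cosK κ (dist m a) (dist m c) (dist a c)) +
      arccos (cosK κ (dist m b) (dist m c) (dist b c)) ≤ π := by
  have ham : a ≠ m := by rintro rfl; simp at ha
  have hbm : b ≠ m := by rintro rfl; simp at hb
  have h := hX.2.2 m a c b ham hc hbm
  unfold cangle at h
  simp only [cangleK_eq] at h
  have h1 : cosK κ (dist m b) (dist m a) (dist b a) = -1 := by
    have e : dist b a = dist m b + dist m a := by
      rw [dist_comm b a, ← hm, dist_comm a m]; ring
    rw [e]
    unfold cosK
    rw [md_add]
    field_simp
    ring
  rw [h1, arccos_neg_one, cosK_comm κ (dist m c) (dist m b), dist_comm c b] at h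
  linarith

/-- Concavity of the modified distance to `c` along a geodesic from `a` to `b` through `m`. -/
theorem IsAlexandrov.md_concave (hX : IsAlexandrov X κ) (h : IsSmallRadius κ R) {a b c m : X}
    (hm : dist a m + dist m b = dist a b) (ham : a ≠ m) (hbm : b ≠ m)
    (hR1 : dist a m + dist c m ≤ R) (hR2 : dist b m + dist c m ≤ R) :
    0 ≤ sn κ (dist b m) * (md κ (dist a m) + (1 - κ * md κ (dist a m)) * md κ (dist c m)
        - md κ (dist c a)) +
      sn κ (dist a m) * (md κ (dist b m) + (1 - κ * md κ (dist b m)) * md κ (dist c m)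
        - md κ (dist c b)) := by
  rcases eq_or_ne c m with rfl | hc
  · rw [dist_comm c a, dist_comm c b]; simp
  have ha0 : 0 < dist a m := dist_pos.2 ham
  have hb0 : 0 < dist b m := dist_pos.2 hbm
  have hc0 : 0 < dist c m := dist_pos.2 hc
  have sa := h.sn_pos ha0 (by linarith)
  have sb := h.sn_pos hb0 (by linarith)
  have sc := h.sn_pos hc0 (by linarith)
  have hq := hX.arccos_add_le hm hc (by rw [dist_comm]; exact sa.ne')
    (by rw [dist_comm]; exact sb.ne')
  rw [dist_comm m a, dist_comm m b, dist_comm m c] at hq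
  have t1 := dist_triangle a m c
  have t2 := dist_triangle a c m
  have t3 := dist_triangle c a m
  rw [dist_comm m c] at t1
  rw [dist_comm c a] at t3
  have t1' := dist_triangle b m c
  have t2' := dist_triangle b c m
  have t3' := dist_triangle c b m
  rw [dist_comm m c] at t1'
  rw [dist_comm c b] at t3'
  have hA := h.abs_cosK_le ha0 hc0 (dist_nonneg (x := a) (y := c)) hR1 t1 t2 (by linarith)
  have hB := h.abs_cosK_le hb0 hc0 (dist_nonneg (x := b) (y := c)) hR2 t1' t2' (by linarith)
  have key : 0 ≤ cosK κ (dist a m) (dist c m) (dist a c) +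
      cosK κ (dist b m) (dist c m) (dist b c) := by
    rcases add_nonneg_or_of_arccos_add_le hA.1 hq with hh | hh <;> linarith
  have e1 : cosK κ (dist a m) (dist c m) (dist a c) * (sn κ (dist a m) * sn κ (dist c m)) =
      md κ (dist a m) + (1 - κ * md κ (dist a m)) * md κ (dist c m) - md κ (dist a c) :=
    div_mul_cancel₀ _ (mul_pos sa sc).ne'
  have e2 : cosK κ (dist b m) (dist c m) (dist b c) * (sn κ (dist b m) * sn κ (dist c m)) =
      md κ (dist b m) + (1 - κ * md κ (dist b m)) * md κ (dist c m) - md κ (dist b c) :=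
    div_mul_cancel₀ _ (mul_pos sb sc).ne'
  rw [dist_comm c a, dist_comm c b, ← e1, ← e2]
  have : 0 ≤ sn κ (dist a m) * sn κ (dist b m) * sn κ (dist c m) *
      (cosK κ (dist a m) (dist c m) (dist a c) + cosK κ (dist b m) (dist c m) (dist b c)) := by
    positivity
  linarith

/-- `m` is a midpoint of `a` and `b`. -/
def IsMidpt (a b m : X) : Prop := dist a m = dist a b / 2 ∧ dist m b = dist a b / 2

theorem IsAlexandrov.md_midpt (hX : IsAlexandrov X κ) (h : IsSmallRadius κ R) {a b c m : X}
    (hm : IsMidpt a b m) (hR : dist a b / 2 + dist c m ≤ R) :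
    md κ (dist c a) + md κ (dist c b) ≤
      2 * (md κ (dist a b / 2) + (1 - κ * md κ (dist a b / 2)) * md κ (dist c m)) := by
  have e1 := hm.1
  have e2 := hm.2
  rw [dist_comm] at e2
  rcases eq_or_ne a b with rfl | hab
  · have : a = m := dist_eq_zero.1 (by rw [e1]; simp)
    subst this
    simp
    linarith
  have hd : 0 < dist a b := dist_pos.2 hab
  have h1 := hX.md_concave h (a := a) (b := b) (c := c) (m := m) (by rw [dist_comm m b]; linarith)
    (dist_pos.1 (by linarith)) (dist_pos.1 (by linarith)) (by linarith) (by linarith)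
  rw [e1, e2] at h1
  have h2 := h.sn_pos (u := dist a b / 2) (by linarith) (by linarith [dist_nonneg (x := c) (y := m)])
  rw [← mul_add] at h1
  have := (mul_nonneg_iff_of_pos_left h2).1 h1
  linarith

/-- Halving one side of a hinge does not decrease the comparison angle. -/
theorem IsAlexandrov.cosK_midpt_le (hX : IsAlexandrov X κ) (h : IsSmallRadius κ R) {a b c m : X}
    (hm : IsMidpt a b m) (hab : a ≠ b) (hac : a ≠ c) (hR : dist a b + dist a c ≤ R) :
    cosK κ (dist a m) (dist a c) (dist m c) ≤ cosK κ (dist a b) (dist a c) (dist b c) := by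
  have hd : 0 < dist a b := dist_pos.2 hab
  have hc : 0 < dist a c := dist_pos.2 hac
  have t := dist_triangle c a m
  rw [hm.1, dist_comm c a] at t
  have h1 := hX.md_midpt h hm (c := c) (by linarith)
  rw [hm.1]
  set u := dist a b / 2 with hu
  have hab2 : dist a b = u + u := by linarith
  have hu0 : 0 < u := by linarith
  rw [hab2]
  have su := h.sn_pos hu0 (by linarith)
  have su2 := h.sn_pos (u := u + u) (by linarith) (by linarith)
  have sc := h.sn_pos hc (by linarith)
  have cu := (h.2 u ⟨hu0.le, by linarith⟩).1
  have e1 := sn_add κ u u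
  have e2 := md_add κ u u
  have e3 := sn_sq κ u
  unfold cosK
  rw [div_le_div_iff₀ (mul_pos su sc) (mul_pos su2 sc), e1]
  have e4 : md κ (u + u) = 2 * md κ u * (1 + (1 - κ * md κ u)) := by rw [e2]; nlinarith
  rw [e4, dist_comm m c, dist_comm b c]
  rw [dist_comm c a] at h1
  generalize md κ (dist c m) = M at *
  generalize md κ (dist c b) = B at *
  generalize md κ (dist a c) = C at *
  generalize sn κ (dist a c) = S at *
  generalize sn κ u = s at *
  have : 0 ≤ s * S * (2 * (md κ u + (1 - κ * md κ u) * M) - C - B) := by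
    have := mul_pos su sc
    apply mul_nonneg this.le; linarith
  nlinarith

end Comparison

section Concavity

variable {X : Type*} [MetricSpace X] {κ R : ℝ}

/-- A sequence of iterated midpoints towards `x`. -/
def IsMidptSeq (x : X) (q : ℕ → X) : Prop := ∀ k, IsMidpt x (q k) (q (k + 1))

theorem IsAlexandrov.exists_isMidptSeq (hX : IsAlexandrov X κ) (x y : X) :
    ∃ q : ℕ → X, q 0 = y ∧ IsMidptSeq x q := by
  choose f hf using hX.2.1
  refine ⟨fun k => (f x)^[k] y, rfl, fun k => ?_⟩
  simp only [Function.iterate_succ_apply']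
  exact hf x _

theorem IsMidptSeq.dist_eq {x : X} {q : ℕ → X} (hq : IsMidptSeq x q) (k : ℕ) :
    dist x (q k) = dist x (q 0) / 2 ^ k := by
  induction k with
  | zero => simp
  | succ k ih => rw [(hq k).1, ih, pow_succ]; ring

theorem IsMidptSeq.dist_add {x : X} {q : ℕ → X} (hq : IsMidptSeq x q) (k : ℕ) :
    dist x (q k) + dist (q k) (q 0) = dist x (q 0) := by
  induction k with
  | zero => simp
  | succ k ih =>
    have h1 := (hq k).1
    have h2 := (hq k).2
    have t1 := dist_triangle (q (k + 1)) (q k) (q 0)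
    have t2 := dist_triangle x (q (k + 1)) (q 0)
    linarith

theorem IsMidptSeq.dist_le {x : X} {q : ℕ → X} (hq : IsMidptSeq x q) (k : ℕ) :
    dist x (q k) ≤ dist x (q 0) := by
  linarith [hq.dist_add k, dist_nonneg (x := q k) (y := q 0)]

theorem IsMidptSeq.tendsto {x : X} {q : ℕ → X} (hq : IsMidptSeq x q) :
    Tendsto (fun k => dist x (q k)) atTop (𝓝 0) := by
  have : Tendsto (fun k : ℕ => dist x (q 0) * (1 / 2 : ℝ) ^ k) atTop (𝓝 (dist x (q 0) * 0)) :=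
    (tendsto_pow_atTop_nhds_zero_of_lt_one (by norm_num) (by norm_num)).const_mul _
  rw [mul_zero] at this
  refine this.congr fun k => ?_
  rw [hq.dist_eq k, div_pow, one_pow]; ring

theorem exists_div_two_pow_lt (a : ℝ) {b : ℝ} (hb : 0 < b) : ∃ k : ℕ, a / 2 ^ k < b := by
  obtain ⟨k, hk⟩ := pow_unbounded_of_one_lt (a / b) (one_lt_two : (1 : ℝ) < 2)
  refine ⟨k, ?_⟩
  rw [div_lt_iff₀ hb] at hk
  rw [div_lt_iff₀ (by positivity)]
  linarith

/-- Near `x ≠ p`, distances to `p` can be localized at a definite small scale. -/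
theorem IsAlexandrov.exists_anchor (hX : IsAlexandrov X κ) (hR : 0 < R) {p x : X} (hpx : p ≠ x) :
    ∃ ρ > 0, ∃ r > 0, ∀ z ∈ ball x r, ∃ p', dist z p' + dist p' p = dist z p ∧
      ρ ≤ dist z p' ∧ dist z p' ≤ R := by
  have hL : 0 < dist x p := dist_pos.2 hpx.symm
  obtain ⟨k, hk⟩ := exists_div_two_pow_lt (2 * dist x p) hR
  refine ⟨dist x p / 2 / 2 ^ k, by positivity, dist x p / 2, by positivity, fun z hz => ?_⟩
  obtain ⟨q, hq0, hq⟩ := hX.exists_isMidptSeq z p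
  have h1 := hq.dist_eq k
  have h2 := hq.dist_add k
  rw [hq0] at h1 h2
  rw [mem_ball] at hz
  have t1 := dist_triangle x z p
  have t2 := dist_triangle z x p
  rw [dist_comm x z] at t1
  refine ⟨q k, h2, ?_, ?_⟩
  · rw [h1]; gcongr; linarith
  · rw [h1]; refine le_trans ?_ hk.le; gcongr; linarith

/-- Semiconcavity tested at midpoints. -/
def MidConcaveOn (f : X → ℝ) (C : ℝ) (s : Set X) : Prop :=
  ∀ a ∈ s, ∀ b ∈ s, ∀ m, IsMidpt a b m → (f a + f b) / 2 ≤ f m + C * dist a b ^ 2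

theorem IsAlexandrov.exists_midConcaveOn (hX : IsAlexandrov X κ) {p x : X} (hpx : p ≠ x) :
    ∃ C ≥ 0, ∃ r > 0, MidConcaveOn (fun z => dist p z) C (ball x r) := by
  obtain ⟨R, h⟩ := exists_isSmallRadius κ
  have hR := h.1
  obtain ⟨ρ, hρ, r, hr, hanch⟩ := hX.exists_anchor (R := R / 2) (by linarith) hpx
  refine ⟨2 / ρ, by positivity, min (r / 2) (R / 8), by positivity, fun a ha b hb m hm => ?_⟩
  simp only [mem_ball, lt_min_iff] at ha hb
  have tab := dist_triangle_right a b x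
  have tm := dist_triangle m a x
  rw [dist_comm m a, hm.1] at tm
  obtain ⟨p', h1, h2, h3⟩ := hanch m (by rw [mem_ball]; linarith)
  have hu : 0 < dist p' m := by rw [dist_comm]; linarith
  rw [dist_comm m p'] at h1 h2 h3
  have hmd := hX.md_midpt h hm (c := p') (by linarith [dist_nonneg (x := a) (y := b)])
  set A := (dist p' a + dist p' b) / 2 with hA
  set D := (dist p' a - dist p' b) / 2 with hD
  have ea : dist p' a = A + D := by rw [hA, hD]; ring
  have eb : dist p' b = A - D := by rw [hA, hD]; ring
  have t1 := dist_triangle p' m a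
  have t2 := dist_triangle p' m b
  rw [dist_comm m a, hm.1] at t1
  rw [hm.2] at t2
  have hA0 : 0 ≤ A := by positivity
  have hAR : A ≤ R := by linarith
  have hDabs : |D| ≤ dist a b / 2 := by
    have := abs_dist_sub_le a b p'
    rw [hD, abs_div, abs_two, dist_comm p' a, dist_comm p' b]; linarith
  have hmdD : 0 ≤ md κ D := by
    rcases abs_cases D with ⟨hh, h0⟩ | ⟨hh, h0⟩
    · exact h.md_nonneg h0 (by linarith)
    · rw [← md_neg]; exact h.md_nonneg (by linarith) (by linarith)
  have e2 : md κ (A + D) + md κ (A - D) = 2 * (md κ A + (1 - κ * md κ A) * md κ D) := by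
    rw [md_add, md_sub]; ring
  have hcsA := (h.2 A ⟨hA0, hAR⟩).1
  rw [ea, eb, e2] at hmd
  have hfin := h.le_add_of_md_le (A := A) (u := dist p' m) (t := dist a b / 2) hA0 hAR hu
    (by linarith) (by positivity) (by linarith) (by nlinarith)
  have hC : 8 * (dist a b / 2) ^ 2 / dist p' m ≤ 2 / ρ * dist a b ^ 2 := by
    rw [div_mul_eq_mul_div, div_le_div_iff₀ hu hρ]
    nlinarith [sq_nonneg (dist a b)]
  have t3 := dist_triangle p p' a
  have t4 := dist_triangle p p' b
  rw [dist_comm p p'] at t3 t4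
  simp only
  rw [dist_comm p m]
  linarith

/-- A semiconcave function lies above its chords up to a linear error. -/
theorem MidConcaveOn.chord {f : X → ℝ} {C : ℝ} {s : Set X} (hf : MidConcaveOn f C s)
    {y : X} {q : ℕ → X} (hq : IsMidptSeq y q) (hy : y ∈ s) (hs : ∀ k, q k ∈ s) (hC : 0 ≤ C)
    (hne : y ≠ q 0) (k : ℕ) :
    dist y (q k) * ((f (q 0) - f y) / dist y (q 0) - 4 * C * dist y (q 0)) ≤ f (q k) - f y := by
  set b := dist y (q 0) with hb
  have hb0 : 0 < b := dist_pos.2 hne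
  have key : ∀ k : ℕ, f (q 0) - f y - 4 * C * b ^ 2 * (1 - 1 / 2 ^ k) ≤
      2 ^ k * (f (q k) - f y) := by
    intro k
    induction k with
    | zero => simp
    | succ k ih =>
      have h1 := hf y hy (q k) (hs k) _ (hq k)
      rw [hq.dist_eq k, ← hb] at h1
      have h2 : 2 ^ (k + 1) * ((f y + f (q k)) / 2) ≤
          2 ^ (k + 1) * (f (q (k + 1)) + C * (b / 2 ^ k) ^ 2) := by gcongr
      have e : (2 : ℝ) ^ (k + 1) * (f (q (k + 1)) + C * (b / 2 ^ k) ^ 2) =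
          2 ^ (k + 1) * f (q (k + 1)) + 2 * C * b ^ 2 * (1 / 2 ^ k) := by
        rw [pow_succ]; field_simp
      rw [e] at h2
      have e3 : (1 : ℝ) / 2 ^ (k + 1) = 1 / 2 ^ k / 2 := by rw [pow_succ]; field_simp
      rw [e3]
      rw [pow_succ (2 : ℝ) k] at h2 ⊢
      linarith
  have h1 := key k
  have h2 : 0 ≤ 4 * C * b ^ 2 * (1 / 2 ^ k) := by positivity
  rw [hq.dist_eq k, ← hb]
  have e : b / 2 ^ k * ((f (q 0) - f y) / b - 4 * C * b) =
      (f (q 0) - f y - 4 * C * b ^ 2) / 2 ^ k := by field_simp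
  rw [e, div_le_iff₀ (by positivity)]
  linarith

/-- At a critical point `z` of `dist y`, moving to `y` increases `dist p` at most
quadratically. -/
theorem IsAlexandrov.dist_le_of_isCriticalPt (hX : IsAlexandrov X κ) {p x : X} (hpx : p ≠ x) :
    ∃ C ≥ 0, ∃ r > 0, ∀ z ∈ ball x r, ∀ y ∈ ball x r, y ≠ z → IsCriticalPt κ y z →
      dist p y ≤ dist p z + C * dist y z ^ 2 := by
  obtain ⟨R, h⟩ := exists_isSmallRadius κ
  have hR := h.1
  obtain ⟨ρ, hρ, r, hr, hanch⟩ := hX.exists_anchor (R := R / 2) (by linarith) hpx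
  refine ⟨8 / ρ, by positivity, min r (R / 8), by positivity, fun z hz y hy hyz hcr => ?_⟩
  simp only [mem_ball, lt_min_iff] at hz hy
  have tyz := dist_triangle_right y z x
  obtain ⟨p', h1, h2, h3⟩ := hanch z hz.1
  have hu : 0 < dist z p' := by linarith
  have hc := hcr p' (dist_pos.1 hu).symm
  unfold cangle at hc
  rw [cangleK_eq, arccos_le_pi_div_two, cosK_comm] at hc
  have hg : 0 < dist z y := dist_pos.2 hyz.symm
  have hyz' := dist_comm y z
  have hpos := mul_pos (h.sn_pos hu (by linarith)) (h.sn_pos hg (by linarith))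
  unfold cosK at hc
  rw [le_div_iff₀ hpos, zero_mul] at hc
  have t := dist_triangle y z p'
  have hfin := h.le_add_of_md_le (A := dist y p') (u := dist z p') (t := dist z y) dist_nonneg
    (by linarith) hu (by linarith) hg.le (by linarith) (by linarith)
  have hC : 8 * dist z y ^ 2 / dist z p' ≤ 8 / ρ * dist z y ^ 2 := by
    rw [div_mul_eq_mul_div]; gcongr
  have t3 := dist_triangle y p' p
  rw [dist_comm p y, dist_comm p z, hyz']
  linarith

end Concavity

section Slope

variable {X : Type*} [MetricSpace X] {κ : ℝ} {p : X}

theorem ascSlope_nonneg (f : X → ℝ) (y : X) : 0 ≤ ascSlope f y := le_max_left _ _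

theorem abs_dist_sub_div_le (p y z : X) : |(dist p z - dist p y) / dist z y| ≤ 1 := by
  rw [abs_div, abs_of_nonneg (dist_nonneg (x := z) (y := y))]
  refine div_le_one_of_le₀ ?_ dist_nonneg
  rw [dist_comm p z, dist_comm p y]
  exact abs_dist_sub_le z y p

theorem isBoundedUnder_slope (p y : X) :
    IsBoundedUnder (· ≤ ·) (𝓝[≠] y) fun z => (dist p z - dist p y) / dist z y :=
  isBoundedUnder_of ⟨1, fun z => (abs_le.1 (abs_dist_sub_div_le p y z)).2⟩

theorem isBoundedUnder_ge_slope (p y : X) :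
    IsBoundedUnder (· ≥ ·) (𝓝[≠] y) fun z => (dist p z - dist p y) / dist z y :=
  isBoundedUnder_of ⟨-1, fun z => (abs_le.1 (abs_dist_sub_div_le p y z)).1⟩

theorem ascSlope_le_one (p y : X) : ascSlope (fun z => dist p z) y ≤ 1 := by
  refine max_le zero_le_one ?_
  rcases eq_or_neBot (𝓝[≠] y) with h | h
  · rw [h]
    simp [limsup, limsSup]
  · exact limsup_le_of_le (isBoundedUnder_ge_slope p y).isCoboundedUnder_le
      (Eventually.of_forall fun z => (abs_le.1 (abs_dist_sub_div_le p y z)).2)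

theorem eventually_dist_sub_le {y : X} {μ : ℝ} (h : ascSlope (fun z => dist p z) y < μ) :
    ∀ᶠ z in 𝓝 y, dist p z - dist p y ≤ μ * dist z y := by
  have h1 := eventually_lt_of_limsup_lt ((le_max_right _ _).trans_lt h) (isBoundedUnder_slope p y)
  rw [eventually_nhdsWithin_iff] at h1
  filter_upwards [h1] with z hz
  rcases eq_or_ne z y with rfl | hzy
  · simp
  · exact ((div_lt_iff₀ (dist_pos.2 hzy)).1 (hz hzy)).le

theorem le_ascSlope_of_frequently {y : X} {c : ℝ}
    (h : ∃ᶠ z in 𝓝[≠] y, c ≤ (dist p z - dist p y) / dist z y) :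
    c ≤ ascSlope (fun z => dist p z) y :=
  (le_limsup_of_frequently_le h (isBoundedUnder_slope p y)).trans (le_max_right _ _)

theorem IsAlexandrov.slope_le_ascSlope (hX : IsAlexandrov X κ) {C r : ℝ} {x y q : X} (hC : 0 ≤ C)
    (hf : MidConcaveOn (fun z => dist p z) C (ball x r)) (hyq : y ≠ q)
    (hr : dist y x + dist y q < r) :
    (dist p q - dist p y) / dist y q - 4 * C * dist y q ≤ ascSlope (fun z => dist p z) y := by
  obtain ⟨s, hs0, hs⟩ := hX.exists_isMidptSeq y q
  subst hs0
  have hpos : ∀ k, 0 < dist y (s k) := fun k => by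
    rw [hs.dist_eq]; exact div_pos (dist_pos.2 hyq) (by positivity)
  have hmem : ∀ k, s k ∈ ball x r := fun k => by
    have := dist_triangle (s k) y x
    rw [dist_comm (s k) y] at this
    rw [mem_ball]; linarith [hs.dist_le k]
  have hch := hf.chord hs (by rw [mem_ball]; linarith [hpos 0]) hmem hC hyq
  apply le_ascSlope_of_frequently
  have ht : Tendsto s atTop (𝓝[≠] y) := by
    refine tendsto_nhdsWithin_iff.2 ⟨tendsto_iff_dist_tendsto_zero.2 ?_, Eventually.of_forall
      fun k => (dist_pos.1 (hpos k)).symm⟩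
    simpa only [dist_comm] using hs.tendsto
  refine ht.frequently (Eventually.of_forall fun k => ?_).frequently
  rw [dist_comm (s k), le_div_iff₀ (hpos k)]
  linarith [hch k]

theorem IsAlexandrov.lowerSemicontinuousAt_ascSlope (hX : IsAlexandrov X κ) {y : X} (hpy : p ≠ y) :
    LowerSemicontinuousAt (ascSlope (fun z => dist p z)) y := by
  intro c hc
  rcases lt_or_ge c 0 with h0 | h0
  · exact Eventually.of_forall fun z => h0.trans_le (ascSlope_nonneg _ _)
  obtain ⟨C, hC, r, hr, hf⟩ := hX.exists_midConcaveOn hpy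
  obtain ⟨c', hcc', hc'⟩ := exists_between hc
  have hlim := (lt_max_iff.1 hc').resolve_left (by linarith)
  have hfr := frequently_lt_of_lt_limsup (by
    rcases eq_or_neBot (𝓝[≠] y) with h | h
    · exfalso
      rw [h] at hlim
      simp [limsup, limsSup] at hlim
      linarith
    · exact (isBoundedUnder_ge_slope p y).isCoboundedUnder_le) hlim
  have hnear : ∀ᶠ z in 𝓝[≠] y, dist y z < r ∧ 4 * C * dist y z < c' - c := by
    have c1 : Continuous fun z => dist y z := by fun_prop
    have c2 : Continuous fun z => 4 * C * dist y z := by fun_prop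
    exact nhdsWithin_le_nhds (((c1.tendsto y).eventually_lt_const (by simpa)).and
      ((c2.tendsto y).eventually_lt_const (by simpa using hcc')))
  obtain ⟨z, hz, hz2, hzy⟩ := (hfr.and_eventually (hnear.and self_mem_nhdsWithin)).exists
  have hzy' : y ≠ z := fun h => hzy h.symm
  have hd : dist y z ≠ 0 := (dist_pos.2 hzy').ne'
  have k1 : ContinuousAt (fun w => (dist p z - dist p w) / dist w z - 4 * C * dist w z) y := by
    fun_prop (disch := exact hd)
  have k2 : ContinuousAt (fun w => dist w y + dist w z) y := by fun_prop
  rw [dist_comm z y] at hz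
  filter_upwards [k1.tendsto.eventually_const_lt (show c < _ by linarith),
    k2.tendsto.eventually_lt_const (show _ < r by simpa using hz2.1),
    isOpen_ne.mem_nhds hzy'] with w h1 h2 h3
  exact h1.trans_le (hX.slope_le_ascSlope hC hf h3 h2)

end Slope

section Curve

variable {X : Type*} [MetricSpace X] {κ : ℝ} {p x : X} {α : ℝ → X}

namespace IsGradCurve

theorem dist_mono (hα : IsGradCurve p x α) {t₁ t₂ : ℝ} (h0 : 0 ≤ t₁) (h : t₁ ≤ t₂) :
    dist p (α t₁) ≤ dist p (α t₂) := by
  have h1 := hα.2.2.2 t₁ t₂ h0 h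
  have h2 : 0 ≤ ∫ t in t₁..t₂, (ascSlope (fun z => dist p z) (α t)) ^ 2 :=
    intervalIntegral.integral_nonneg h fun t _ => sq_nonneg _
  linarith

theorem ne (hα : IsGradCurve p x α) (hpx : p ≠ x) {t : ℝ} (ht : 0 ≤ t) : p ≠ α t := by
  have := hα.dist_mono le_rfl ht
  rw [hα.1] at this
  exact dist_pos.1 ((dist_pos.2 hpx).trans_le this)

theorem continuous_extend (hα : IsGradCurve p x α) : Continuous fun t => α (max t 0) :=
  hα.2.1.comp_continuous (by fun_prop) fun t => le_max_right t 0

theorem lowerSemicontinuous (hα : IsGradCurve p x α) (hX : IsAlexandrov X κ) (hpx : p ≠ x) :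
    LowerSemicontinuous fun t => ascSlope (fun z => dist p z) (α (max t 0)) := fun t c hc =>
  hα.continuous_extend.continuousAt.eventually
    (hX.lowerSemicontinuousAt_ascSlope (hα.ne hpx (le_max_right t 0)) c hc)

theorem intervalIntegrable_pow (hα : IsGradCurve p x α) (hX : IsAlexandrov X κ) (hpx : p ≠ x)
    (n : ℕ) {t₁ t₂ : ℝ} (h0 : 0 ≤ t₁) (h : t₁ ≤ t₂) :
    IntervalIntegrable (fun t => ascSlope (fun z => dist p z) (α t) ^ n) MeasureTheory.volume
      t₁ t₂ := by
  rw [intervalIntegrable_iff_integrableOn_Icc_of_le h]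
  have hm : Measurable fun t => ascSlope (fun z => dist p z) (α (max t 0)) ^ n :=
    (hα.lowerSemicontinuous hX hpx).measurable.pow_const n
  have : MeasureTheory.IntegrableOn (fun t => ascSlope (fun z => dist p z) (α (max t 0)) ^ n)
      (Icc t₁ t₂) := by
    refine MeasureTheory.Measure.integrableOn_of_bounded (M := 1) (by simp)
      hm.aestronglyMeasurable (Eventually.of_forall fun t => ?_)
    rw [norm_of_nonneg (pow_nonneg (ascSlope_nonneg _ _) _)]
    exact pow_le_one₀ (ascSlope_nonneg _ _) (ascSlope_le_one _ _)
  refine this.congr_fun (fun t ht => ?_) measurableSet_Icc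
  simp only [max_eq_left (h0.trans ht.1)]

theorem two_mul_dist_le (hα : IsGradCurve p x α) (hX : IsAlexandrov X κ) (hpx : p ≠ x)
    {t₁ t₂ : ℝ} (h0 : 0 ≤ t₁) (h : t₁ ≤ t₂) {c : ℝ} (hc : 0 ≤ c) :
    2 * c * dist (α t₁) (α t₂) ≤ dist p (α t₂) - dist p (α t₁) + c ^ 2 * (t₂ - t₁) := by
  have i1 := hα.intervalIntegrable_pow hX hpx 1 h0 h
  have i2 := hα.intervalIntegrable_pow hX hpx 2 h0 h
  simp only [pow_one] at i1
  have h1 := mul_le_mul_of_nonneg_left (hα.2.2.1 t₁ t₂ h0 h) (by positivity : 0 ≤ 2 * c)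
  rw [hα.2.2.2 t₁ t₂ h0 h]
  refine h1.trans ?_
  rw [← intervalIntegral.integral_const_mul]
  have h3 := intervalIntegral.integral_mono_on h (i1.const_mul (2 * c))
    (i2.add (intervalIntegrable_const (c := c ^ 2))) (fun t _ => by
      nlinarith [sq_nonneg (ascSlope (fun z => dist p z) (α t) - c)])
  refine h3.trans (le_of_eq ?_)
  rw [intervalIntegral.integral_add i2 intervalIntegrable_const, intervalIntegral.integral_const,
    smul_eq_mul]
  ring

theorem dist_le (hα : IsGradCurve p x α) (hX : IsAlexandrov X κ) (hpx : p ≠ x)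
    {t₁ t₂ : ℝ} (h0 : 0 ≤ t₁) (h : t₁ ≤ t₂) : dist (α t₁) (α t₂) ≤ t₂ - t₁ := by
  have h1 := hα.two_mul_dist_le hX hpx h0 h zero_le_one
  have h2 := dist_triangle p (α t₁) (α t₂)
  linarith

theorem tendsto_right (hα : IsGradCurve p x α) {t : ℝ} (ht : 0 ≤ t) {c : ℝ} (hc : 0 ≤ c) :
    Tendsto (fun s => α (t + c * s)) (𝓝[>] 0) (𝓝 (α t)) := by
  have h1 : Continuous fun s => α (max (t + c * s) 0) :=
    hα.continuous_extend.comp (by fun_prop : Continuous fun s => t + c * s)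
  have h2 := (h1.tendsto 0).mono_left (nhdsWithin_le_nhds (s := Ioi 0))
  simp only [mul_zero, add_zero, max_eq_left ht] at h2
  refine h2.congr' ?_
  filter_upwards [self_mem_nhdsWithin] with s hs
  rw [max_eq_left (add_nonneg ht (mul_nonneg hc (le_of_lt hs)))]

theorem eventually_dist_sub_le' (hα : IsGradCurve p x α) {t : ℝ} (ht : 0 ≤ t) {μ : ℝ}
    (hμ : ascSlope (fun z => dist p z) (α t) < μ) :
    ∀ᶠ s in 𝓝[>] 0, dist p (α (t + s)) - dist p (α t) ≤ μ * dist (α t) (α (t + s)) := by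
  have h := (hα.tendsto_right ht zero_le_one).eventually (eventually_dist_sub_le hμ)
  simpa only [one_mul, dist_comm (α t)] using h

theorem eventually_dist_le (hα : IsGradCurve p x α) (hX : IsAlexandrov X κ) (hpx : p ≠ x)
    {t : ℝ} (ht : 0 ≤ t) {μ : ℝ} (hμ : ascSlope (fun z => dist p z) (α t) < μ) :
    ∀ᶠ s in 𝓝[>] 0, dist (α t) (α (t + s)) ≤ μ * s := by
  have hμ0 : 0 < μ := (ascSlope_nonneg _ _).trans_lt hμ
  filter_upwards [hα.eventually_dist_sub_le' ht hμ, self_mem_nhdsWithin] with s h1 hs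
  have hs : 0 < s := hs
  have h2 := hα.two_mul_dist_le hX hpx ht (by linarith : t ≤ t + s) hμ0.le
  have h3 : μ * dist (α t) (α (t + s)) ≤ μ * (μ * s) := by linarith
  exact le_of_mul_le_mul_left h3 hμ0

theorem eventually_le_dist_sub (hα : IsGradCurve p x α) (hX : IsAlexandrov X κ) (hpx : p ≠ x)
    {t : ℝ} (ht : 0 ≤ t) {ν : ℝ} (hν0 : 0 ≤ ν) (hν : ν < ascSlope (fun z => dist p z) (α t)) :
    ∀ᶠ s in 𝓝[>] 0, ν ^ 2 * s ≤ dist p (α (t + s)) - dist p (α t) := by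
  have h1 := hα.lowerSemicontinuous hX hpx t ν (by simpa only [max_eq_left ht])
  obtain ⟨r, hr, h1⟩ := Metric.eventually_nhds_iff.1 h1
  filter_upwards [Ioo_mem_nhdsGT hr] with s hs
  have hs1 := hs.1
  have h2 : t ≤ t + s := by linarith
  rw [hα.2.2.2 t (t + s) ht h2]
  have h3 := intervalIntegral.integral_mono_on h2 (intervalIntegrable_const (c := ν ^ 2))
    (hα.intervalIntegrable_pow hX hpx 2 ht h2) (fun τ hτ => by
      have h4 := @h1 τ (by
        rw [Real.dist_eq, abs_of_nonneg (by linarith [hτ.1])]; linarith [hτ.2, hs.2])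
      simp only [max_eq_left (ht.trans hτ.1)] at h4
      gcongr)
  rw [intervalIntegral.integral_const, smul_eq_mul] at h3
  linarith

theorem tendsto_dist_sub_div (hα : IsGradCurve p x α) (hX : IsAlexandrov X κ) (hpx : p ≠ x)
    {t : ℝ} (ht : 0 ≤ t) :
    Tendsto (fun s => (dist p (α (t + s)) - dist p (α t)) / s) (𝓝[>] 0)
      (𝓝 (ascSlope (fun z => dist p z) (α t) ^ 2)) := by
  set σ := ascSlope (fun z => dist p z) (α t) with hσ
  have hσ0 : 0 ≤ σ := ascSlope_nonneg _ _
  have hσ1 : σ ≤ 1 := ascSlope_le_one _ _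
  refine tendsto_order.2 ⟨fun a ha => ?_, fun a ha => ?_⟩
  · rcases hσ0.eq_or_lt with h | h
    · rw [← h] at ha
      filter_upwards [self_mem_nhdsWithin] with s hs
      have hs : 0 < s := hs
      refine lt_of_lt_of_le (by simpa using ha) (div_nonneg ?_ hs.le)
      linarith [hα.dist_mono ht (by linarith : t ≤ t + s)]
    · have hc : ContinuousAt (fun u : ℝ => u ^ 2) σ := by fun_prop
      obtain ⟨ν, h1, h2, h3⟩ := (((hc.mono_left (nhdsWithin_le_nhds (s := Iio σ))).eventually
        (lt_mem_nhds ha)).and (Ioo_mem_nhdsLT h)).exists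
      filter_upwards [hα.eventually_le_dist_sub hX hpx ht h2.le h3, self_mem_nhdsWithin] with s h4 hs
      rw [lt_div_iff₀ hs]
      have hs : 0 < s := hs
      exact lt_of_lt_of_le (by gcongr) h4
  · have hc : ContinuousAt (fun u : ℝ => u ^ 2) σ := by fun_prop
    obtain ⟨μ, h1, h2⟩ := (((hc.mono_left (nhdsWithin_le_nhds (s := Ioi σ))).eventually
      (gt_mem_nhds ha)).and self_mem_nhdsWithin).exists
    have h2 : σ < μ := h2
    filter_upwards [hα.eventually_dist_sub_le' ht h2, hα.eventually_dist_le hX hpx ht h2,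
      self_mem_nhdsWithin] with s h3 h4 hs
    have hs : 0 < s := hs
    rw [div_lt_iff₀ hs]
    nlinarith

theorem tendsto_dist_div (hα : IsGradCurve p x α) (hX : IsAlexandrov X κ) (hpx : p ≠ x)
    {t : ℝ} (ht : 0 ≤ t) :
    Tendsto (fun s => dist (α t) (α (t + s)) / s) (𝓝[>] 0)
      (𝓝 (ascSlope (fun z => dist p z) (α t))) := by
  set σ := ascSlope (fun z => dist p z) (α t) with hσ
  have hσ0 : 0 ≤ σ := ascSlope_nonneg _ _
  refine tendsto_order.2 ⟨fun a ha => ?_, fun a ha => ?_⟩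
  · rcases hσ0.eq_or_lt with h | h
    · filter_upwards [self_mem_nhdsWithin] with s hs
      exact (h.symm ▸ ha).trans_le (div_nonneg dist_nonneg (le_of_lt hs))
    · have hc : ContinuousAt (fun u : ℝ => σ ^ 2 / u) σ := by fun_prop (disch := exact h.ne')
      have hh : a < σ ^ 2 / σ := by rwa [sq, mul_div_assoc, div_self h.ne', mul_one]
      obtain ⟨μ, h1, h2⟩ := (((hc.mono_left (nhdsWithin_le_nhds (s := Ioi σ))).eventually
        (lt_mem_nhds hh)).and self_mem_nhdsWithin).exists
      have h2 : σ < μ := h2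
      have hμ : 0 < μ := h.trans h2
      rw [lt_div_iff₀ hμ] at h1
      filter_upwards [hα.eventually_dist_sub_le' ht h2, self_mem_nhdsWithin,
        (hα.tendsto_dist_sub_div hX hpx ht).eventually (lt_mem_nhds h1)] with s h3 hs h4
      have hs : 0 < s := hs
      rw [lt_div_iff₀ hs] at h4 ⊢
      refine lt_of_mul_lt_mul_left (a := μ) ?_ hμ.le
      linarith
  · obtain ⟨μ, h1, h2⟩ := exists_between ha
    filter_upwards [hα.eventually_dist_le hX hpx ht h1, self_mem_nhdsWithin] with s h3 hs
    have hs : 0 < s := hs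
    rw [div_lt_iff₀ hs]
    nlinarith

theorem tendsto_two_mul {g : ℝ → ℝ} {l : ℝ} (h : Tendsto (fun s => g s / s) (𝓝[>] 0) (𝓝 l)) :
    Tendsto (fun s => g (2 * s) / s) (𝓝[>] 0) (𝓝 (2 * l)) := by
  have h2 : Tendsto (fun s : ℝ => 2 * s) (𝓝[>] 0) (𝓝[>] 0) := by
    refine tendsto_nhdsWithin_iff.2 ⟨?_, ?_⟩
    · have : Continuous fun s : ℝ => 2 * s := by fun_prop
      simpa using (this.tendsto 0).mono_left (nhdsWithin_le_nhds (s := Ioi 0))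
    · filter_upwards [self_mem_nhdsWithin] with s hs
      have hs : 0 < s := hs
      simpa using hs
  refine ((h.comp h2).const_mul 2).congr' ?_
  filter_upwards [self_mem_nhdsWithin] with s hs
  have hs : 0 < s := hs
  simp only [Function.comp]
  field_simp

theorem tendsto_dist_div_next (hα : IsGradCurve p x α) (hX : IsAlexandrov X κ) (hpx : p ≠ x)
    {t : ℝ} (ht : 0 ≤ t) (hσ : 0 < ascSlope (fun z => dist p z) (α t)) :
    Tendsto (fun s => dist (α (t + s)) (α (t + 2 * s)) / s) (𝓝[>] 0)
      (𝓝 (ascSlope (fun z => dist p z) (α t))) := by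
  set σ := ascSlope (fun z => dist p z) (α t)
  have a1 := hα.tendsto_dist_div hX hpx ht
  have a2 := tendsto_two_mul a1
  have f1 := hα.tendsto_dist_sub_div hX hpx ht
  have f2 := tendsto_two_mul (g := fun s => dist p (α (t + s)) - dist p (α t)) f1
  have lo : Tendsto (fun s => dist (α t) (α (t + 2 * s)) / s - dist (α t) (α (t + s)) / s)
      (𝓝[>] 0) (𝓝 σ) := by
    have := a2.sub a1
    rwa [show 2 * σ - σ = σ by ring] at this
  have hi : Tendsto (fun s => ((dist p (α (t + 2 * s)) - dist p (α t)) / s -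
      (dist p (α (t + s)) - dist p (α t)) / s + σ ^ 2) / (2 * σ)) (𝓝[>] 0) (𝓝 σ) := by
    have := ((f2.sub f1).add_const (σ ^ 2)).div_const (2 * σ)
    rwa [show (2 * σ ^ 2 - σ ^ 2 + σ ^ 2) / (2 * σ) = σ by field_simp; ring] at this
  refine tendsto_of_tendsto_of_tendsto_of_le_of_le' lo hi ?_ ?_
  · filter_upwards [self_mem_nhdsWithin] with s hs
    have hs : 0 < s := hs
    rw [← sub_div]
    gcongr
    linarith [dist_triangle (α t) (α (t + s)) (α (t + 2 * s))]
  · filter_upwards [self_mem_nhdsWithin] with s hs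
    have hs : 0 < s := hs
    have h1 := hα.two_mul_dist_le hX hpx (by linarith : 0 ≤ t + s)
      (by linarith : t + s ≤ t + 2 * s) hσ.le
    rw [le_div_iff₀ (by positivity), div_mul_eq_mul_div, div_le_iff₀ hs, add_mul, ← sub_div,
      div_mul_cancel₀ _ hs.ne']
    linarith

end IsGradCurve

end Curve

theorem neg_sub_le_of_arccos_add_le {u₁ u₂ u₃ θ : ℝ} (h₂ : u₂ ∈ Icc (-1 : ℝ) 1)
    (h₃ : u₃ ∈ Icc (-1 : ℝ) 1) (h₁ : arccos (-u₁) ≤ θ)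
    (h : arccos u₁ + arccos u₂ + arccos u₃ ≤ 2 * π) : -u₃ - θ ≤ u₂ := by
  rw [arccos_neg] at h₁
  have e₂ := cos_arccos h₂.1 h₂.2
  have e₃ := cos_arccos h₃.1 h₃.2
  have hθ : 0 ≤ θ := by linarith [arccos_le_pi u₁]
  rcases le_total (arccos u₂) (π - arccos u₃) with hh | hh
  · have := cos_le_cos_of_nonneg_of_le_pi (arccos_nonneg u₂)
      (by linarith [arccos_nonneg u₃]) hh
    rw [cos_pi_sub] at this
    linarith
  · have h5 := abs_cos_sub_cos_le (arccos u₂) (π - arccos u₃)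
    rw [abs_of_nonneg (by linarith : 0 ≤ arccos u₂ - (π - arccos u₃)), cos_pi_sub, e₂, e₃] at h5
    linarith [(abs_le.1 h5).1]

theorem tendsto_sn_div (κ : ℝ) : Tendsto (fun e => sn κ e / e) (𝓝[>] 0) (𝓝 1) := by
  have h := (hasDerivAt_iff_tendsto_slope_zero.1 (hasDerivAt_sn κ 0)).mono_left
    (nhdsWithin_mono 0 (fun u (hu : 0 < u) => hu.ne'))
  simp only [md_zero, mul_zero, sub_zero, zero_add, sn_zero, smul_eq_mul] at h
  refine h.congr fun e => ?_
  ring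

theorem tendsto_div_sn (κ : ℝ) : Tendsto (fun e => e / sn κ e) (𝓝[>] 0) (𝓝 1) := by
  have := (tendsto_sn_div κ).inv₀ one_ne_zero
  simpa only [inv_div, inv_one] using this

namespace IsSmallRadius

variable {κ R : ℝ}

theorem cosK_le (h : IsSmallRadius κ R) {a e x η : ℝ} (ha : 0 < a) (he : 0 < e) (hx : 0 ≤ x)
    (haR : a ≤ R) (heR : e ≤ R) (hxR : x ≤ R) (hax : |a - x| ≤ e) (hη : |e / sn κ e - 1| ≤ η) :
    cosK κ e a x ≤ (a - x) / e + η + 16 * (e / a) := by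
  have sa := h.sn_pos ha haR
  have se := h.sn_pos he heR
  have h1 := h.md_tangent ha.le haR hx hxR
  have h2 := (h.2 a ⟨ha.le, haR⟩).2
  have h3 := h.md_le he.le heR
  have h4 := h.md_nonneg he.le heR
  have h5 : cosK κ e a x ≤ (sn κ a * (a - x) + 4 * e ^ 2) / (sn κ a * sn κ e) := by
    rw [cosK_comm]
    unfold cosK
    gcongr
    nlinarith
  have h6 : (sn κ a * (a - x) + 4 * e ^ 2) / (sn κ a * sn κ e) =
      (a - x) / e * (e / sn κ e) + 4 * e ^ 2 / (sn κ a * sn κ e) := by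
    field_simp
  have h7 : 4 * e ^ 2 / (sn κ a * sn κ e) ≤ 16 * (e / a) := by
    rw [← mul_div_assoc, div_le_div_iff₀ (by positivity) ha]
    have := mul_le_mul (h.half_le_sn ha.le haR) (h.half_le_sn he.le heR) (by positivity) sa.le
    nlinarith
  have h8 : |(a - x) / e| ≤ 1 := by
    rw [abs_div, abs_of_pos he]
    exact div_le_one_of_le₀ hax he.le
  have h9 : (a - x) / e * (e / sn κ e) ≤ (a - x) / e + η := by
    have : (a - x) / e * (e / sn κ e - 1) ≤ η := by
      refine (le_abs_self _).trans ?_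
      rw [abs_mul]
      calc _ ≤ 1 * |e / sn κ e - 1| := by gcongr
        _ ≤ η := by linarith
    linarith
  linarith

end IsSmallRadius

section Key

variable {X : Type*} [MetricSpace X] {κ R : ℝ} {p x : X} {α : ℝ → X}

theorem IsAlexandrov.cosK_midptSeq_le (hX : IsAlexandrov X κ) (h : IsSmallRadius κ R) {a c : X}
    {q : ℕ → X} (hq : IsMidptSeq a q) (hab : a ≠ q 0) (hac : a ≠ c)
    (hR : dist a (q 0) + dist a c ≤ R) (k : ℕ) :
    cosK κ (dist a (q k)) (dist a c) (dist (q k) c) ≤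
      cosK κ (dist a (q 0)) (dist a c) (dist (q 0) c) := by
  induction k with
  | zero => rfl
  | succ k ih =>
    refine (hX.cosK_midpt_le h (hq k) ?_ hac ?_).trans ih
    · rw [← dist_pos, hq.dist_eq]
      exact div_pos (dist_pos.2 hab) (by positivity)
    · linarith [hq.dist_le k]

theorem eventually_mul_lt (c : ℝ) {ρ : ℝ} (hρ : 0 < ρ) : ∀ᶠ s : ℝ in 𝓝[>] 0, c * s < ρ := by
  have : Continuous fun s : ℝ => c * s := by fun_prop
  exact ((this.tendsto 0).mono_left nhdsWithin_le_nhds).eventually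
    (gt_mem_nhds (by simpa using hρ))

namespace IsGradCurve

theorem exists_cosK_le (hα : IsGradCurve p x α) (hX : IsAlexandrov X κ) (h : IsSmallRadius κ R)
    (hpx : p ≠ x) {t : ℝ} (ht : 0 ≤ t) (hσ : 0 < ascSlope (fun z => dist p z) (α t))
    {D : X → ℝ} (hD : ContinuousAt D (α t)) {c : ℝ}
    (hc : -D (α t) / ascSlope (fun z => dist p z) (α t) < c) :
    ∃ η > 0, ∀ᶠ s in 𝓝[>] 0, ∀ m, η * s ≤ dist (α (t + s)) m → dist (α (t + s)) m ≤ 2 * η * s →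
      dist (α (t + s)) m * D (α (t + s)) ≤ dist p m - dist p (α (t + s)) →
      cosK κ (dist (α (t + s)) m) (dist (α (t + s)) (α t)) (dist m (α t)) ≤ c := by
  set y := α t with hy
  set σ := ascSlope (fun z => dist p z) y with hσdef
  have hσ1 : σ ≤ 1 := ascSlope_le_one _ _
  obtain ⟨η, hη, hηc⟩ : ∃ η > 0, -D y / σ + 64 * η / σ < c := by
    refine ⟨(c - -D y / σ) * σ / 128, by have := sub_pos.2 hc; positivity, ?_⟩
    have : 64 * ((c - -D y / σ) * σ / 128) / σ = (c - -D y / σ) / 2 := by field_simp; ring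
    linarith
  refine ⟨η, hη, ?_⟩
  have hφ : ContinuousAt (fun v => (-D y + v + 4 * v / η) / (σ + v) + v + 64 * η / σ) 0 := by
    fun_prop (disch := simpa using hσ.ne')
  have hφ0 := hφ.eventually (gt_mem_nhds (show _ < c by simpa using hηc))
  obtain ⟨v, hvc, hv0, hv1⟩ := ((hφ0.filter_mono (nhdsWithin_le_nhds (s := Ioi 0))).and
    (Ioo_mem_nhdsGT (half_pos hσ))).exists
  have hev := eventually_dist_sub_le (p := p) (y := y) (show σ < σ + v by linarith)
  obtain ⟨r, hr, hev⟩ := Metric.eventually_nhds_iff.1 hev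
  obtain ⟨ρ, hρ, hsn⟩ := mem_nhdsGT_iff_exists_Ioo_subset.1
    ((tendsto_div_sn κ).eventually (Metric.ball_mem_nhds 1 hv0))
  have hρ : 0 < ρ := hρ
  have hDz : ∀ᶠ s in 𝓝[>] 0, D y - v < D (α (t + s)) := by
    have := (hα.tendsto_right ht zero_le_one)
    simp only [one_mul] at this
    exact (hD.tendsto.comp this).eventually (lt_mem_nhds (by linarith))
  have hR := h.1
  filter_upwards [self_mem_nhdsWithin, hDz, eventually_mul_lt (2 * η) hρ,
    eventually_mul_lt (2 + 2 * η) hr, eventually_mul_lt (2 + 2 * η) hR,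
    (hα.tendsto_dist_div hX hpx ht).eventually (Metric.ball_mem_nhds _ hv0),
    (hα.tendsto_dist_sub_div hX hpx ht).eventually (Metric.ball_mem_nhds _ hv0)]
    with s hs hDz s1 s2 s3 ha hF m hm1 hm2 hm3
  have hs : 0 < s := hs
  set z := α (t + s)
  rw [Real.dist_eq, abs_lt] at ha hF
  rw [dist_comm y z] at ha
  have e0 : 0 < dist z m := lt_of_lt_of_le (by positivity) hm1
  have ha1 : (σ - v) * s < dist z y := by
    rw [← lt_div_iff₀ hs]; linarith
  have ha2 : dist z y < (σ + v) * s := by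
    rw [← div_lt_iff₀ hs]; linarith
  have hF1 : (σ ^ 2 - v) * s < dist p z - dist p y := by
    rw [← lt_div_iff₀ hs]; linarith
  have ha3 : σ / 2 * s < dist z y := lt_of_le_of_lt (by gcongr; linarith) ha1
  have ha0 : 0 < dist z y := lt_trans (by positivity) ha3
  have ha4 : dist z y < 2 * s := ha2.trans_le (by gcongr; linarith)
  have tx := dist_triangle m z y
  have tx2 := dist_triangle z m y
  rw [dist_comm m z] at tx
  have hx := hev (show dist m y < r by linarith)
  have hsn' := @hsn (dist z m) ⟨e0, by linarith⟩
  change dist _ _ < v at hsn'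
  rw [Real.dist_eq] at hsn'
  refine (h.cosK_le ha0 e0 dist_nonneg (by linarith) (by linarith) (by linarith)
    (abs_le.2 ⟨by linarith, by linarith⟩) hsn'.le).trans (le_trans ?_ hvc.le)
  have q1 : 16 * (dist z m / dist z y) ≤ 64 * η / σ := by
    rw [← mul_div_assoc, div_le_div_iff₀ ha0 hσ]
    have i1 := mul_le_mul_of_nonneg_right hm2 hσ.le
    have i2 := mul_le_mul_of_nonneg_left ha3.le hη.le
    linarith
  have q2 : (dist z y - dist m y) / dist z m ≤ (-D y + v + 4 * v / η) / (σ + v) := by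
    rw [div_le_div_iff₀ e0 (by linarith)]
    have q3 : (σ + v) * (dist z y - dist m y) ≤ -(dist z m * D z) + 4 * v * s := by
      have : (σ + v) * dist z y ≤ (σ + v) * ((σ + v) * s) := by gcongr
      have i0 := mul_nonneg hv0.le hs.le
      have i1 := mul_le_mul_of_nonneg_right hσ1 i0
      have i2 := mul_le_mul_of_nonneg_right (show v ≤ 1 by linarith) i0
      linarith
    have q4 : 4 * v * s ≤ 4 * v / η * dist z m := by
      have : 4 * v * s = 4 * v / η * (η * s) := by field_simp
      rw [this]; gcongr
    have i1 := mul_le_mul_of_nonneg_left hDz.le e0.le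
    linarith
  linarith

end IsGradCurve

end Key

section Key

variable {X : Type*} [MetricSpace X] {κ R : ℝ} {p x : X} {α : ℝ → X}

theorem exists_half_pow_mem {b e : ℝ} (he : 0 < e) (hb : e ≤ b) :
    ∃ k : ℕ, e ≤ b / 2 ^ k ∧ b / 2 ^ k ≤ 2 * e := by
  obtain ⟨k, h1, h2⟩ := exists_nat_pow_near ((one_le_div he).2 hb) (one_lt_two : (1 : ℝ) < 2)
  rw [le_div_iff₀ he] at h1
  rw [div_lt_iff₀ he, pow_succ] at h2
  refine ⟨k, ?_, ?_⟩
  · rw [le_div_iff₀ (by positivity)]; linarith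
  · rw [div_le_iff₀ (by positivity)]; linarith

namespace IsGradCurve

theorem tendsto_dist_next (hα : IsGradCurve p x α) {t : ℝ} (ht : 0 ≤ t) :
    Tendsto (fun s => dist (α (t + s)) (α (t + 2 * s))) (𝓝[>] 0) (𝓝 0) := by
  have h1 := hα.tendsto_right ht zero_le_one
  simp only [one_mul] at h1
  simpa using h1.dist (hα.tendsto_right ht zero_le_two)

theorem eventually_arccos_le (hα : IsGradCurve p x α) (hX : IsAlexandrov X κ)
    (h : IsSmallRadius κ R) (hpx : p ≠ x) {t : ℝ} (ht : 0 ≤ t)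
    (hσ : 0 < ascSlope (fun z => dist p z) (α t)) {θ : ℝ} (hθ : 0 < θ) :
    ∀ᶠ s in 𝓝[>] 0, arccos (-cosK κ (dist (α (t + s)) (α t)) (dist (α (t + s)) (α (t + 2 * s)))
      (dist (α t) (α (t + 2 * s)))) ≤ θ := by
  set σ := ascSlope (fun z => dist p z) (α t) with hσdef
  have l1 := hα.tendsto_dist_div hX hpx ht
  have l2 := hα.tendsto_dist_div_next hX hpx ht hσ
  have l3 := tendsto_two_mul l1
  rw [← hσdef] at l1 l2 l3
  have hlim := ((((l1.add l2).mul ((l1.add l2).sub l3)).const_mul 8).div (l1.mul l2)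
    (mul_pos hσ hσ).ne')
  rw [show (8 : ℝ) * ((σ + σ) * (σ + σ - 2 * σ)) / (σ * σ) = 0 by
    rw [show σ + σ - 2 * σ = 0 by ring]; simp] at hlim
  have hcos := (continuous_arccos.tendsto (1 - 0)).comp (hlim.const_sub 1)
  rw [sub_zero, arccos_one] at hcos
  have t1 := hα.tendsto_right ht zero_le_one
  simp only [one_mul] at t1
  have t2 : Tendsto (fun s => dist (α t) (α (t + s)) + dist (α (t + s)) (α (t + 2 * s)))
      (𝓝[>] 0) (𝓝 0) := by
    simpa using ((tendsto_const_nhds (x := α t)).dist t1).add (hα.tendsto_dist_next ht)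
  filter_upwards [self_mem_nhdsWithin, hcos.eventually (gt_mem_nhds hθ),
    l1.eventually (lt_mem_nhds hσ), l2.eventually (lt_mem_nhds hσ),
    t2.eventually (gt_mem_nhds h.1)] with s hs h1 h2 h3 h4
  have hs : 0 < s := hs
  refine le_trans (antitone_arccos ?_) h1.le
  rw [dist_comm (α (t + s)) (α t)]
  have tw := dist_triangle (α t) (α (t + s)) (α (t + 2 * s))
  set a := dist (α t) (α (t + s))
  set b := dist (α (t + s)) (α (t + 2 * s))
  set w := dist (α t) (α (t + 2 * s))
  have ha : 0 < a := by by_contra hc; exact absurd h2 (not_lt.2 (div_nonpos_of_nonpos_of_nonneg (not_lt.1 hc) hs.le))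
  have hb : 0 < b := by by_contra hc; exact absurd h3 (not_lt.2 (div_nonpos_of_nonpos_of_nonneg (not_lt.1 hc) hs.le))
  have hw : 0 ≤ w := dist_nonneg
  have sa := h.sn_pos ha (by linarith)
  have sb := h.sn_pos hb (by linarith)
  have m1 := (h.md_bounds hw tw h4.le).2
  have m2 := h.sn_le (add_pos ha hb).le h4.le
  have e1 : -cosK κ a b w = 1 - (md κ (a + b) - md κ w) / (sn κ a * sn κ b) := by
    unfold cosK
    rw [md_add]
    field_simp
    ring
  have e2 : 8 * ((a / s + b / s) * (a / s + b / s - w / s)) / (a / s * (b / s)) =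
      8 * (a + b) * (a + b - w) / (a * b) := by
    field_simp
  rw [e1]
  refine sub_le_sub_left (le_trans ?_ e2.ge) 1
  rw [div_le_div_iff₀ (by positivity) (by positivity)]
  have n1 : md κ (a + b) - md κ w ≤ 2 * (a + b) * (a + b - w) :=
    m1.trans (mul_le_mul_of_nonneg_right m2 (by linarith))
  have n2 := mul_le_mul (h.half_le_sn ha.le (by linarith)) (h.half_le_sn hb.le (by linarith))
    (by positivity) sa.le
  calc (md κ (a + b) - md κ w) * (a * b) ≤ 2 * (a + b) * (a + b - w) * (a * b) := by gcongr
    _ = 8 * (a + b) * (a + b - w) * (a / 2 * (b / 2)) := by ring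
    _ ≤ 8 * (a + b) * (a + b - w) * (sn κ a * sn κ b) := by
      refine mul_le_mul_of_nonneg_left n2 (mul_nonneg (by positivity) (by linarith))

theorem eventually_le_cosK (hα : IsGradCurve p x α) (hX : IsAlexandrov X κ)
    (h : IsSmallRadius κ R) (hpx : p ≠ x) {t : ℝ} (ht : 0 ≤ t)
    (hσ : 0 < ascSlope (fun z => dist p z) (α t)) {C r : ℝ} {y₀ q : X} (hC : 0 ≤ C)
    (hf : MidConcaveOn (fun z => dist p z) C (ball y₀ r)) (hq : α t ≠ q)
    (hr : dist (α t) y₀ + dist (α t) q < r) (hR : dist (α t) q < R) {c : ℝ}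
    (hc : -((dist p q - dist p (α t)) / dist (α t) q - 4 * C * dist (α t) q) /
      ascSlope (fun z => dist p z) (α t) < c) :
    ∀ᶠ s in 𝓝[>] 0, -c ≤ cosK κ (dist (α (t + s)) q) (dist (α (t + s)) (α (t + 2 * s)))
      (dist q (α (t + 2 * s))) := by
  obtain ⟨c', hc1, hc2⟩ := exists_between hc
  have hqd : dist (α t) q ≠ 0 := (dist_pos.2 hq).ne'
  obtain ⟨η, hη, hη'⟩ := hα.exists_cosK_le hX h hpx ht hσ
    (D := fun z => (dist p q - dist p z) / dist z q - 4 * C * dist z q)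
    (by fun_prop (disch := exact hqd)) hc1
  have t1 := hα.tendsto_right ht zero_le_one
  simp only [one_mul] at t1
  have k1 : Continuous fun w => dist w y₀ + dist w q := by fun_prop
  have k2 : Tendsto (fun s => dist (α (t + s)) q + dist (α (t + s)) (α (t + 2 * s)))
      (𝓝[>] 0) (𝓝 (dist (α t) q)) := by
    simpa using (t1.dist (tendsto_const_nhds (x := q))).add (hα.tendsto_dist_next ht)
  have k3 : Tendsto (fun s => dist (α t) (α (t + s)) + dist (α (t + s)) (α (t + 2 * s)))
      (𝓝[>] 0) (𝓝 0) := by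
    simpa using ((tendsto_const_nhds (x := α t)).dist t1).add (hα.tendsto_dist_next ht)
  have k4 : Tendsto (fun s => dist (α (t + s)) q) (𝓝[>] 0) (𝓝 (dist (α t) q)) :=
    t1.dist tendsto_const_nhds
  filter_upwards [hη', self_mem_nhdsWithin,
    hα.eventually_arccos_le hX h hpx ht hσ (sub_pos.2 hc2),
    ((k1.tendsto _).comp t1).eventually (gt_mem_nhds hr), k2.eventually (gt_mem_nhds hR),
    k3.eventually (gt_mem_nhds (half_pos h.1)),
    (hα.tendsto_dist_div hX hpx ht).eventually (lt_mem_nhds hσ),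
    (hα.tendsto_dist_div_next hX hpx ht hσ).eventually (lt_mem_nhds hσ),
    eventually_mul_lt (2 * η) (half_pos h.1),
    k4.eventually (lt_mem_nhds (half_lt_self (dist_pos.2 hq))),
    eventually_mul_lt η (half_pos (dist_pos.2 hq))]
    with s hA hs hθ hr' hR' hR2 ha hb hs1 hqz hs2
  have hs : 0 < s := hs
  simp only [Function.comp] at hr'
  set y := α t
  set z := α (t + s)
  set z' := α (t + 2 * s)
  have ha : 0 < dist y z := by
    by_contra hc; exact absurd ha (not_lt.2 (div_nonpos_of_nonpos_of_nonneg (not_lt.1 hc) hs.le))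
  have hb : 0 < dist z z' := by
    by_contra hc; exact absurd hb (not_lt.2 (div_nonpos_of_nonpos_of_nonneg (not_lt.1 hc) hs.le))
  obtain ⟨m, hm0, hm⟩ := hX.exists_isMidptSeq z q
  obtain ⟨k, hk1, hk2⟩ := exists_half_pow_mem (mul_pos hη hs) (hs2.trans hqz).le
  rw [← hm0, ← hm.dist_eq k] at hk1 hk2
  have he : 0 < dist z (m k) := lt_of_lt_of_le (by positivity) hk1
  have hzq : z ≠ m 0 := dist_pos.1 (he.trans_le (hm.dist_le k))
  have hmem : ∀ j, m j ∈ ball y₀ r := fun j => by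
    have e1 := dist_triangle (m j) z y₀
    have e2 := hm.dist_le j
    rw [dist_comm (m j) z] at e1
    rw [hm0] at e2
    rw [mem_ball]; linarith
  have hzb : z ∈ ball y₀ r := by
    rw [mem_ball]; linarith [dist_nonneg (x := z) (y := q)]
  have hch := hf.chord hm hzb hmem hC hzq k
  rw [hm0] at hch
  have hA3 := hA (m k) hk1 (by linarith) hch
  have hquad := hX.2.2 z y z' (m k) (dist_pos.1 ha) (dist_pos.1 hb).symm (dist_pos.1 he).symm
  unfold cangle at hquad
  simp only [cangleK_eq] at hquad
  have hit := hX.cosK_midptSeq_le h hm hzq (dist_pos.1 hb) (by rw [hm0]; exact hR'.le) k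
  rw [hm0, cosK_comm, dist_comm (m k)] at hit
  have c1 := dist_comm y z
  have v1 := dist_triangle z' z (m k)
  have v2 := dist_triangle z z' (m k)
  have v3 := dist_triangle z (m k) z'
  have v4 := dist_triangle (m k) z y
  have v5 := dist_triangle z (m k) y
  have v6 := dist_triangle z y (m k)
  have c2 := dist_comm z z'
  have c3 := dist_comm (m k) z'
  have c4 := dist_comm (m k) z
  have c5 := dist_comm (m k) y
  have b2 := h.abs_cosK_le hb he (dist_nonneg (x := z') (y := m k)) (by linarith) (by linarith)
    (by linarith) (by linarith)
  have b3 := h.abs_cosK_le he (c1 ▸ ha) (dist_nonneg (x := m k) (y := y)) (by linarith)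
    (by linarith) (by linarith) (by linarith)
  have := neg_sub_le_of_arccos_add_le b2 b3 hθ hquad
  linarith

theorem eventually_dist_sub_dist_le (hα : IsGradCurve p x α) (hX : IsAlexandrov X κ)
    (h : IsSmallRadius κ R) (hpx : p ≠ x) {t : ℝ} (ht : 0 ≤ t)
    (hσ : 0 < ascSlope (fun z => dist p z) (α t)) {C r : ℝ} {y₀ q : X} (hC : 0 ≤ C)
    (hf : MidConcaveOn (fun z => dist p z) C (ball y₀ r)) (hq : α t ≠ q)
    (hr : dist (α t) y₀ + dist (α t) q < r) (hR : dist (α t) q < R) {ε : ℝ} (hε : 0 < ε) :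
    ∀ᶠ s in 𝓝[>] 0, dist q (α (t + 2 * s)) - dist q (α (t + s)) ≤
      (-((dist p q - dist p (α t)) / dist (α t) q - 4 * C * dist (α t) q) + ε) * s := by
  set δ := (dist p q - dist p (α t)) / dist (α t) q - 4 * C * dist (α t) q with hδ
  set σ := ascSlope (fun z => dist p z) (α t) with hσdef
  have hq0 := dist_pos.2 hq
  have hA := hα.eventually_le_cosK hX h hpx ht hσ hC hf hq hr hR
    (c := (-δ + ε / 2) / σ) (by rw [← hδ, ← hσdef]; gcongr; linarith)
  have t1 := hα.tendsto_right ht zero_le_one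
  simp only [one_mul] at t1
  have l2 := hα.tendsto_dist_div_next hX hpx ht hσ
  rw [← hσdef] at l2
  have l3 := hα.tendsto_dist_next ht
  have k4 : Tendsto (fun s => dist (α (t + s)) q) (𝓝[>] 0) (𝓝 (dist (α t) q)) :=
    t1.dist tendsto_const_nhds
  have k2 : Tendsto (fun s => dist (α (t + s)) q + dist (α (t + s)) (α (t + 2 * s)))
      (𝓝[>] 0) (𝓝 (dist (α t) q)) := by
    simpa using k4.add l3
  have hpos : ∀ᶠ s in 𝓝[>] 0, 0 < dist (α (t + s)) (α (t + 2 * s)) := by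
    filter_upwards [self_mem_nhdsWithin, l2.eventually (lt_mem_nhds hσ)] with s hs hb
    by_contra hc
    exact absurd hb (not_lt.2 (div_nonpos_of_nonpos_of_nonneg (not_lt.1 hc) (le_of_lt hs)))
  have l4 := (tendsto_sn_div κ).comp (tendsto_nhdsWithin_iff.2 ⟨l3, hpos⟩)
  have hlim := ((l4.mul l2).const_mul ((-δ + ε / 2) / σ)).add
    (((l3.mul l2).const_mul 8).div k4 hq0.ne')
  have hlt : (-δ + ε / 2) / σ * (1 * σ) + 8 * (0 * σ) / dist (α t) q < -δ + ε := by
    have : (-δ + ε / 2) / σ * (1 * σ) = -δ + ε / 2 := by field_simp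
    rw [this]; simp; linarith
  filter_upwards [hA, hpos, self_mem_nhdsWithin, k2.eventually (gt_mem_nhds hR),
    k4.eventually (lt_mem_nhds hq0), hlim.eventually (gt_mem_nhds hlt)] with s hA hb hs hR' hb0 hfin
  have hs : 0 < s := hs
  simp only [Function.comp] at hfin
  set z := α (t + s)
  set z' := α (t + 2 * s)
  set b := dist z q
  set a := dist z z'
  have c1 : dist q z = b := dist_comm q z
  have c2 : a = dist z z' := rfl
  have tr := dist_triangle q z z'
  have d0 : 0 ≤ dist q z' := dist_nonneg
  rw [c1] at tr ⊢
  set d := dist q z'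
  have sb := h.sn_pos hb0 (by linarith)
  have sa := h.sn_pos hb (by linarith)
  have h1 := h.md_tangent hb0.le (by linarith) d0 (by linarith)
  have h2 := (h.2 b ⟨hb0.le, by linarith⟩).2
  have h3 := h.md_le hb.le (by linarith)
  have h4 := h.md_nonneg hb.le (by linarith)
  have h5 := h.half_le_sn hb0.le (by linarith)
  unfold cosK at hA
  rw [le_div_iff₀ (mul_pos sb sa)] at hA
  set c := (-δ + ε / 2) / σ
  have h6 : sn κ b * (d - b) ≤ sn κ b * (c * sn κ a + 8 * a ^ 2 / b) := by
    have : 4 * a ^ 2 ≤ sn κ b * (8 * a ^ 2 / b) := by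
      rw [mul_div_assoc', le_div_iff₀ hb0]
      nlinarith [sq_nonneg a]
    nlinarith
  have h7 := le_of_mul_le_mul_left h6 sb
  have h8 : c * sn κ a + 8 * a ^ 2 / b = (c * (sn κ a / a * (a / s)) + 8 * (a * (a / s)) / b) * s := by
    field_simp
  rw [h8] at h7
  exact h7.trans (mul_le_mul_of_nonneg_right (le_of_lt hfin) hs.le)

/-- First variation along a gradient curve: if `dist p` grows at rate `δ` (up to the
semiconcavity error) from `α t` to `q`, then the curve approaches `q` at rate at least `δ`. -/
theorem eventually_dist_le_add (hα : IsGradCurve p x α) (hX : IsAlexandrov X κ)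
    (h : IsSmallRadius κ R) (hpx : p ≠ x) {t : ℝ} (ht : 0 ≤ t)
    {C r : ℝ} {y₀ q : X} (hC : 0 ≤ C)
    (hf : MidConcaveOn (fun z => dist p z) C (ball y₀ r)) (hq : α t ≠ q)
    (hr : dist (α t) y₀ + dist (α t) q < r) (hR : dist (α t) q < R) {ε : ℝ} (hε : 0 < ε) :
    ∀ᶠ s in 𝓝[>] 0, dist q (α (t + s)) ≤ dist q (α t) +
      (-((dist p q - dist p (α t)) / dist (α t) q - 4 * C * dist (α t) q) + ε) * s := by
  set δ := (dist p q - dist p (α t)) / dist (α t) q - 4 * C * dist (α t) q with hδ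
  rcases (ascSlope_nonneg (fun z => dist p z) (α t)).eq_or_lt with hσ | hσ
  · have h1 := hX.slope_le_ascSlope hC hf hq hr
    rw [← hδ, ← hσ] at h1
    filter_upwards [hα.eventually_dist_le hX hpx ht (hσ ▸ hε), self_mem_nhdsWithin] with s h2 hs
    have hs : 0 < s := hs
    have h3 := dist_triangle q (α t) (α (t + s))
    nlinarith
  · obtain ⟨ρ, hρ, hev⟩ := mem_nhdsGT_iff_exists_Ioo_subset.1
      (hα.eventually_dist_sub_dist_le hX h hpx ht hσ hC hf hq hr hR hε)
    have hρ : 0 < ρ := hρ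
    filter_upwards [Ioo_mem_nhdsGT hρ] with s hs
    have hs0 := hs.1
    have key : ∀ n : ℕ, dist q (α (t + s)) - (-δ + ε) * s ≤
        dist q (α (t + s / 2 ^ n)) - (-δ + ε) * (s / 2 ^ n) := by
      intro n
      induction n with
      | zero => simp
      | succ n ih =>
        refine ih.trans ?_
        have e : s / 2 ^ n = 2 * (s / 2 ^ (n + 1)) := by rw [pow_succ]; field_simp
        have hle : s / 2 ^ (n + 1) ≤ s := div_le_self hs0.le (one_le_pow₀ one_le_two)
        have h1 : dist q (α (t + 2 * (s / 2 ^ (n + 1)))) - dist q (α (t + s / 2 ^ (n + 1))) ≤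
            (-δ + ε) * (s / 2 ^ (n + 1)) := hev ⟨by positivity, hle.trans_lt hs.2⟩
        rw [e]
        linarith
    have hs2 : Tendsto (fun n : ℕ => s / 2 ^ n) atTop (𝓝[>] 0) := by
      refine tendsto_nhdsWithin_iff.2 ⟨?_, Eventually.of_forall fun n => ?_⟩
      · exact tendsto_const_nhds.div_atTop (tendsto_pow_atTop_atTop_of_one_lt one_lt_two)
      · exact div_pos hs0 (by positivity)
    have t1 := hα.tendsto_right ht zero_le_one
    simp only [one_mul] at t1
    have hlim : Tendsto (fun n : ℕ => dist q (α (t + s / 2 ^ n)) - (-δ + ε) * (s / 2 ^ n)) atTop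
        (𝓝 (dist q (α t) - (-δ + ε) * 0)) :=
      ((tendsto_const_nhds (x := q)).dist (t1.comp hs2)).sub
        ((hs2.mono_right nhdsWithin_le_nhds).const_mul _)
    have := ge_of_tendsto' hlim key
    linarith

end IsGradCurve

end Key

theorem cosK_mul {κ s t : ℝ} (d : ℝ) (hs : sn κ s ≠ 0) (ht : sn κ t ≠ 0) :
    cosK κ s t d * (sn κ s * sn κ t) = md κ s + (1 - κ * md κ s) * md κ t - md κ d :=
  div_mul_cancel₀ _ (mul_ne_zero hs ht)

theorem cosK_add_mul {κ a b u t d : ℝ} (ha : sn κ a ≠ 0) (hb : sn κ b ≠ 0) (hu : sn κ u ≠ 0) :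
    (cosK κ a u t + cosK κ b u d) * (sn κ a * sn κ b * sn κ u) =
      sn κ a * (md κ (a + b) + (1 - κ * md κ (a + b)) * md κ t - md κ d) -
        sn κ (a + b) * (md κ a + (1 - κ * md κ a) * md κ t - md κ u) := by
  have e : (cosK κ a u t + cosK κ b u d) * (sn κ a * sn κ b * sn κ u) =
      sn κ b * (md κ a + (1 - κ * md κ a) * md κ u - md κ t) +
        sn κ a * (md κ b + (1 - κ * md κ b) * md κ u - md κ d) := by
    rw [← cosK_mul t ha hu, ← cosK_mul d hb hu]; ring
  rw [e, md_add, sn_add]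
  linear_combination (κ * md κ t * sn κ b - sn κ b) * sn_sq κ a

theorem exists_add_mul_le_of_cosK_neg {κ s t d : ℝ} (hR : cosK κ s t d < 0) :
    ∃ c > 0, ∀ᶠ a in 𝓝[>] 0, sn κ a ≠ 0 ∧ sn κ (s - a) ≠ 0 ∧ ∀ u, |u - t| ≤ a →
      arccos (cosK κ a u t) + arccos (cosK κ (s - a) u d) ≤ π → t + c * a ≤ u := by
  have hs : sn κ s ≠ 0 := fun h => by simp [cosK, h] at hR
  have ht : sn κ t ≠ 0 := fun h => by simp [cosK, h] at hR
  set R := cosK κ s t d with hRdef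
  have ht2 : 0 < sn κ t ^ 2 := by positivity
  have hs2 : 0 < sn κ s ^ 2 := by positivity
  obtain ⟨ρ, hρ, hsgn⟩ := Metric.eventually_nhds_iff.1
    (((continuous_sn κ).const_mul (sn κ t)).continuousAt.eventually
      (lt_mem_nhds (mul_self_pos.2 ht)))
  have hmono : StrictMonoOn (fun τ => sn κ t * md κ τ) (Ioo (t - ρ) (t + ρ)) := by
    refine strictMonoOn_of_deriv_pos (convex_Ioo _ _)
      ((continuous_md κ).const_mul _).continuousOn fun τ hτ => ?_
    rw [interior_Ioo] at hτ
    rw [((hasDerivAt_md κ τ).const_mul (sn κ t)).deriv]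
    exact hsgn (by rw [Real.dist_eq, abs_lt]; constructor <;> linarith [hτ.1, hτ.2])
  obtain ⟨ρ', hρ', hder⟩ := Metric.eventually_nhds_iff.1
    (((hasDerivAt_md κ t).const_mul (sn κ t)).isLittleO.def
      (c := -R * sn κ t ^ 2 / 4) (by have := neg_pos.2 hR; positivity))
  have hmd : Tendsto (fun a => md κ a / a) (𝓝[>] 0) (𝓝 0) := by
    have h := (hasDerivAt_iff_tendsto_slope_zero.1 (hasDerivAt_md κ 0)).mono_left
      (nhdsWithin_mono 0 (fun u (hu : 0 < u) => hu.ne'))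
    simp only [zero_add, md_zero, sub_zero, sn_zero, smul_eq_mul] at h
    refine h.congr fun e => ?_
    ring
  have hL := ((tendsto_sn_div κ).mul_const (-R * sn κ t ^ 2)).add
    (hmd.mul_const (sn κ t * (1 - κ * md κ t)))
  have hLlt : -R * sn κ t ^ 2 * (3 / 4) < 1 * (-R * sn κ t ^ 2) +
      0 * (sn κ t * (1 - κ * md κ t)) := by
    have := mul_pos (neg_pos.2 hR) ht2
    linarith
  have hsa : Tendsto (fun a => sn κ s * sn κ (s - a)) (𝓝[>] 0) (𝓝 (sn κ s * sn κ (s - 0))) :=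
    (((continuous_sn κ).comp (continuous_sub_left s)).const_mul _).tendsto 0 |>.mono_left
      nhdsWithin_le_nhds
  refine ⟨min 1 (-R / 2), lt_min one_pos (by linarith), ?_⟩
  filter_upwards [self_mem_nhdsWithin, hL.eventually (lt_mem_nhds hLlt),
    hsa.eventually (lt_mem_nhds (by rw [sub_zero]; exact mul_self_pos.2 hs)),
    (tendsto_sn_div κ).eventually (lt_mem_nhds one_pos), eventually_mul_lt 2 hρ,
    eventually_mul_lt 2 hρ'] with a ha hLa hb hsna ha1 ha2
  have ha : 0 < a := ha
  have sa : 0 < sn κ a := by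
    by_contra hc; exact absurd hsna (not_lt.2 (div_nonpos_of_nonpos_of_nonneg (not_lt.1 hc) ha.le))
  have hb' : sn κ (s - a) ≠ 0 := fun h => by rw [h] at hb; simp at hb
  refine ⟨sa.ne', hb', fun u hu harc => ?_⟩
  obtain ⟨hu1, hu2⟩ := abs_le.1 hu
  have su : 0 < sn κ t * sn κ u := hsgn (by rw [Real.dist_eq]; linarith)
  have su' : sn κ u ≠ 0 := fun h => by rw [h] at su; simp at su
  have hpos : 0 < sn κ a * (sn κ t * sn κ u) := mul_pos sa su
  have hA := cosK_mul t sa.ne' su'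
  set A := cosK κ a u t
  have mem : ∀ τ, |τ - t| ≤ 2 * a → τ ∈ Ioo (t - ρ) (t + ρ) := fun τ hτ => by
    obtain ⟨h1, h2⟩ := abs_le.1 hτ
    constructor <;> linarith
  have mt : t ∈ Ioo (t - ρ) (t + ρ) := mem t (by simp; positivity)
  have hA1 : -1 ≤ A := by
    have h1 : (A + 1) * (sn κ a * (sn κ t * sn κ u)) = sn κ t * md κ (a + u) - sn κ t * md κ t := by
      rw [md_add]; linear_combination sn κ t * hA
    have h2 := hmono.monotoneOn mt (mem (a + u) (abs_le.2 ⟨by linarith, by linarith⟩))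
      (by linarith)
    have h3 : 0 ≤ (A + 1) * (sn κ a * (sn κ t * sn κ u)) := by rw [h1]; exact sub_nonneg.2 h2
    linarith [nonneg_of_mul_nonneg_left h3 hpos]
  rcases add_nonneg_or_of_arccos_add_le hA1 harc with hh | hh
  · have hfac := cosK_add_mul (t := t) (d := d) sa.ne' hb' su'
    rw [add_sub_cancel, ← cosK_mul d hs ht, ← hRdef] at hfac
    have h1 : 0 ≤ (A + cosK κ (s - a) u d) * (sn κ a * sn κ (s - a) * sn κ u) *
        (sn κ s * sn κ t) := by
      have : (A + cosK κ (s - a) u d) * (sn κ a * sn κ (s - a) * sn κ u) * (sn κ s * sn κ t) =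
          (A + cosK κ (s - a) u d) * ((sn κ s * sn κ (s - a)) *
            (sn κ a * (sn κ t * sn κ u))) := by ring
      rw [this]
      exact mul_nonneg hh (mul_pos hb hpos).le
    rw [hfac] at h1
    have h2 : 0 ≤ sn κ s ^ 2 * (sn κ t ^ 2 * sn κ a * R -
        sn κ t * (md κ a + (1 - κ * md κ a) * md κ t - md κ u)) := by linarith
    have h3 := nonneg_of_mul_nonneg_right h2 hs2
    have h4 := hder (show dist u t < ρ' by rw [Real.dist_eq]; linarith)
    simp only [smul_eq_mul, Real.norm_eq_abs] at h4
    have h5 := (abs_le.1 h4).2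
    have h6 : -R * sn κ t ^ 2 / 4 * |u - t| ≤ -R * sn κ t ^ 2 / 4 * a := by
      have := neg_pos.2 hR
      gcongr
    have h7 : -R * sn κ t ^ 2 * (3 / 4) * a <
        sn κ a * (-R * sn κ t ^ 2) + md κ a * (sn κ t * (1 - κ * md κ t)) := by
      rw [← lt_div_iff₀ ha]
      refine hLa.trans_eq ?_
      ring
    have h8 : sn κ t ^ 2 * (-R / 2 * a) ≤ sn κ t ^ 2 * (u - t) := by linarith
    have h9 := le_of_mul_le_mul_left h8 ht2
    have := mul_le_mul_of_nonneg_right (min_le_right 1 (-R / 2)) ha.le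
    linarith
  · have h1 : (A - 1) * (sn κ a * (sn κ t * sn κ u)) = sn κ t * md κ (u - a) - sn κ t * md κ t := by
      rw [← neg_sub a u, md_neg, md_sub]; linear_combination sn κ t * hA
    have h3 : 0 ≤ (A - 1) * (sn κ a * (sn κ t * sn κ u)) := mul_nonneg (by linarith) hpos.le
    rw [h1] at h3
    have h2 := (hmono.le_iff_le mt (mem (u - a) (abs_le.2 ⟨by linarith, by linarith⟩))).1
      (sub_nonneg.1 h3)
    have := mul_le_mul_of_nonneg_right (min_le_left 1 (-R / 2)) ha.le
    linarith

section Invariant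

variable {X : Type*} [MetricSpace X] {κ : ℝ}

/-- If the comparison angle at `x` between `q` and `p` is obtuse, then moving from `x` towards
`q` increases the distance to `p` at a definite rate. -/
theorem IsAlexandrov.exists_add_mul_le (hX : IsAlexandrov X κ) {p x : X} {m : ℕ → X}
    (hm : IsMidptSeq x m) (hpx : p ≠ x) (hang : π / 2 < cangle κ (m 0) x p) :
    x ≠ m 0 ∧ ∃ c > 0, ∀ᶠ k in atTop, dist p x + c * dist x (m k) ≤ dist p (m k) := by
  have hR : cosK κ (dist x (m 0)) (dist x p) (dist (m 0) p) < 0 := by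
    unfold cangle at hang
    rw [cangleK_eq] at hang
    by_contra hc
    exact absurd hang (not_lt.2 (arccos_le_pi_div_two.2 (not_lt.1 hc)))
  have hne : x ≠ m 0 := fun h => by rw [← h] at hR; simp [cosK] at hR
  obtain ⟨c, hc, hev⟩ := exists_add_mul_le_of_cosK_neg hR
  have hlim : Tendsto (fun k => dist x (m k)) atTop (𝓝[>] 0) :=
    tendsto_nhdsWithin_iff.2 ⟨hm.tendsto, Eventually.of_forall fun k => by
      rw [hm.dist_eq]; exact div_pos (dist_pos.2 hne) (by positivity)⟩
  refine ⟨hne, c, hc, ?_⟩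
  filter_upwards [hlim.eventually hev, hm.tendsto.eventually (gt_mem_nhds (dist_pos.2 hpx.symm))]
    with k hk hk2
  have h1 := hm.dist_add k
  have hpm : p ≠ m k := fun h => by rw [← h] at hk2; exact lt_irrefl _ hk2
  have e : dist x (m 0) - dist x (m k) = dist (m k) (m 0) := by linarith
  rw [e] at hk
  have harc := hX.arccos_add_le h1 hpm (by rw [dist_comm]; exact hk.1) hk.2.1
  rw [dist_comm (m k) x] at harc
  have h2 := hk.2.2 (dist (m k) p) (by rw [dist_comm x (m k)]; exact abs_dist_sub_le _ _ _) harc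
  rw [dist_comm p x, dist_comm p (m k)]
  exact h2

theorem IsAlexandrov.isExtremal_of_forall_mem (hX : IsAlexandrov X κ) {gc : X → X → ℝ → X}
    (hgc : ∀ p x : X, p ≠ x → IsGradCurve p x (gc p x)) {E : Set X} (hcl : IsClosed E)
    (hE : ∀ p x : X, x ∈ E → p ≠ x → ∀ t ≥ (0 : ℝ), gc p x t ∈ E) : IsExtremal κ E := by
  refine ⟨hcl, fun q _ x hx hmin y hyx => ?_⟩
  by_contra hang
  rw [not_le] at hang
  obtain ⟨m, rfl, hm⟩ := hX.exists_isMidptSeq x q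
  obtain ⟨hne, c, hc, hev⟩ := hX.exists_add_mul_le hm hyx hang
  obtain ⟨C, hC, r, hr, hf⟩ := hX.exists_midConcaveOn hyx
  obtain ⟨R, hR⟩ := exists_isSmallRadius κ
  have h4 : ∀ᶠ a in 𝓝 (0 : ℝ), 4 * C * a < c :=
    ((continuous_const_mul (4 * C)).tendsto 0).eventually (gt_mem_nhds (by simpa using hc))
  obtain ⟨k, hk, hkr, hkR, hk4⟩ := (hev.and ((hm.tendsto.eventually (gt_mem_nhds hr)).and
    ((hm.tendsto.eventually (gt_mem_nhds hR.1)).and (hm.tendsto.eventually h4)))).exists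
  have hα := hgc y x hyx
  have ha : 0 < dist x (m k) := by
    rw [hm.dist_eq]; exact div_pos (dist_pos.2 hne) (by positivity)
  have hα0 := hα.1
  have hδ : 0 < (dist y (m k) - dist y x) / dist x (m k) - 4 * C * dist x (m k) := by
    have : c ≤ (dist y (m k) - dist y x) / dist x (m k) := by rw [le_div_iff₀ ha]; linarith
    linarith
  have key := hα.eventually_dist_le_add hX hR hyx le_rfl (q := m k) hC hf
    (by rw [hα0]; exact dist_pos.1 ha) (by rw [hα0]; simpa using hkr) (by rw [hα0]; exact hkR)
    (half_pos hδ)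
  rw [hα0] at key
  have ht : Tendsto (fun s => gc y x (0 + 1 * s)) (𝓝[>] 0) (𝓝[E] x) := by
    refine tendsto_nhdsWithin_iff.2 ⟨?_, ?_⟩
    · have := hα.tendsto_right le_rfl zero_le_one
      rwa [hα0] at this
    · filter_upwards [self_mem_nhdsWithin] with s hs
      have hs : 0 < s := hs
      exact hE y x hx hyx _ (by simpa using hs.le)
  obtain ⟨s, h1, h2, hs⟩ := (key.and ((ht.eventually hmin).and self_mem_nhdsWithin)).exists
  have hs : 0 < s := hs
  rw [one_mul] at h2
  have t1 := dist_triangle (m 0) (m k) (gc y x (0 + s))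
  have t2 := hm.dist_add k
  have c1 := dist_comm x (m k)
  have c2 := dist_comm x (m 0)
  have c3 := dist_comm (m 0) (m k)
  have := mul_pos hδ hs
  linarith

end Invariant

section Nearest

variable {X : Type*} [MetricSpace X] {κ R : ℝ} {E : Set X}

/-- Points whose almost nearest points in `E` form a set of diameter at most `η`. -/
def almostNearestSet (E : Set X) (η : ℝ) : Set X :=
  {y | ∃ ρ > 0, ∀ z ∈ E, ∀ z' ∈ E, dist y z < infDist y E + ρ → dist y z' < infDist y E + ρ →
    dist z z' ≤ η}

theorem isOpen_almostNearestSet (E : Set X) (η : ℝ) : IsOpen (almostNearestSet E η) := by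
  refine Metric.isOpen_iff.2 fun y ⟨ρ, hρ, hy⟩ => ⟨ρ / 4, by positivity, fun y' hy' => ?_⟩
  rw [mem_ball] at hy'
  have h1 := infDist_le_infDist_add_dist (s := E) (x := y') (y := y)
  have h2 := dist_comm y y'
  refine ⟨ρ / 4, by positivity, fun z hz z' hz' h3 h4 => hy z hz z' hz' ?_ ?_⟩
  · linarith [dist_triangle y y' z]
  · linarith [dist_triangle y y' z']

theorem IsAlexandrov.dist_le_of_almost_nearest (hX : IsAlexandrov X κ) (h : IsSmallRadius κ R)
    {y z₁ m z : X} {ε : ℝ} (hε : 0 ≤ ε) (hm : dist y m + dist m z₁ = dist y z₁) (hym : y ≠ m)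
    (hzm : z₁ ≠ m) (hL : dist y z₁ ≤ R / 4) (hεR : ε ≤ R / 8) (hεL : ε ≤ dist y z₁)
    (hv : dist m z ≤ dist m z₁ + ε) (hw : dist y z₁ - ε ≤ dist y z) :
    dist y m * dist z z₁ ^ 2 ≤ 320 * R ^ 2 * ε := by
  have hR := h.1
  have c1 := dist_comm m z₁
  have c2 := dist_comm m z
  have c3 := dist_comm y z
  have l0 : 0 < dist y m := dist_pos.2 hym
  have b0 : 0 < dist m z₁ := dist_pos.2 hzm.symm
  have t1 := dist_triangle z m z₁
  have t2 := dist_triangle z m y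
  rw [dist_comm m y] at t2
  have hc := hX.md_concave h (c := z) hm hym hzm (by linarith) (by linarith)
  rw [← c1, ← c2, ← c3] at hc
  rw [← c3] at t2
  rw [← c2] at t1 t2
  set l := dist y m
  set b := dist m z₁
  set v := dist m z
  set w := dist y z
  set d := dist z z₁
  set L := dist y z₁
  have v0 : 0 ≤ v := dist_nonneg
  have d0 : 0 ≤ d := dist_nonneg
  have sl := h.sn_pos l0 (by linarith)
  have sb := h.sn_pos b0 (by linarith)
  have sl2 := h.sn_le l0.le (by linarith)
  have sb2 := h.sn_le b0.le (by linarith)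
  have sl3 := h.half_le_sn l0.le (by linarith)
  have mv : md κ v ≤ md κ b + 2 * R * ε := by
    have h1 := h.md_mono v0 hv (by linarith)
    have h2 := (h.md_bounds b0.le (by linarith : b ≤ b + ε) (by linarith)).2
    have h3 := h.sn_le (u := b + ε) (by linarith) (by linarith)
    have h4 : sn κ (b + ε) * (b + ε - b) ≤ 2 * R * ε := by
      rw [add_sub_cancel_left]; gcongr; linarith
    linarith
  have mw : md κ L - 2 * R * ε ≤ md κ w := by
    have h1 := h.md_mono (by linarith) hw (by linarith)
    have h2 := (h.md_bounds (by linarith) (by linarith : L - ε ≤ L) (by linarith)).2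
    have h3 := h.sn_le (u := L) (by linarith) (by linarith)
    have h4 : sn κ L * (L - (L - ε)) ≤ 2 * R * ε := by
      rw [sub_sub_cancel]; gcongr; linarith
    linarith
  have Cl := h.2 l ⟨l0.le, by linarith⟩
  have Cb := h.2 b ⟨b0.le, by linarith⟩
  have hRε : 0 ≤ 2 * R * ε := by positivity
  have f1 : md κ l + (1 - κ * md κ l) * md κ v - md κ w ≤
      -(sn κ l * sn κ b) + 6 * R * ε := by
    rw [← hm, md_add] at mw
    have := mul_le_mul_of_nonneg_left mv (by linarith [Cl.1] : 0 ≤ 1 - κ * md κ l)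
    have := mul_le_mul_of_nonneg_right Cl.2 hRε
    linarith
  have f2 : md κ b + (1 - κ * md κ b) * md κ v - md κ d ≤ sn κ b ^ 2 + 4 * R * ε - md κ d := by
    rw [sn_sq]
    have := mul_le_mul_of_nonneg_left mv (by linarith [Cb.1] : 0 ≤ 1 - κ * md κ b)
    have := mul_le_mul_of_nonneg_right Cb.2 hRε
    linarith
  have g1 := mul_le_mul_of_nonneg_left f1 sb.le
  have g2 := mul_le_mul_of_nonneg_left f2 sl.le
  have g3 : sn κ b * (6 * R * ε) ≤ 2 * R * (6 * R * ε) := by gcongr; linarith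
  have g4 : sn κ l * (4 * R * ε) ≤ 2 * R * (4 * R * ε) := by gcongr; linarith
  have g5 : sn κ l * md κ d ≤ 20 * R ^ 2 * ε := by linarith
  have g6 : l / 2 * (d ^ 2 / 8) ≤ sn κ l * md κ d :=
    mul_le_mul sl3 (h.sq_le_md d0 (by linarith)) (by positivity) sl.le
  linarith

theorem IsAlexandrov.dense_almostNearestSet (hX : IsAlexandrov X κ) (h : IsSmallRadius κ R)
 (hne : E.Nonempty) {η : ℝ} (hη : 0 < η) :
    Dense ({y | R / 8 < infDist y E} ∪ almostNearestSet E η) := by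
  have hR := h.1
  refine Metric.dense_iff.2 fun y δ hδ => ?_
  rcases lt_or_ge (R / 8) (infDist y E) with hg | hg
  · exact ⟨y, mem_ball_self hδ, Or.inl hg⟩
  rcases (infDist_nonneg (x := y) (s := E)).eq_or_lt with hg0 | hg0
  · refine ⟨y, mem_ball_self hδ, Or.inr ⟨η / 2, by positivity, fun z _ z' _ h1 h2 => ?_⟩⟩
    linarith [dist_triangle_left z z' y]
  set g := infDist y E with hgdef
  obtain ⟨k, hk⟩ := exists_div_two_pow_lt (2 * g) hδ
  obtain ⟨k, hk, hk1⟩ : ∃ k : ℕ, 2 * g / 2 ^ k < δ ∧ k ≠ 0 := by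
    refine ⟨k + 1, lt_of_le_of_lt ?_ hk, by simp⟩
    gcongr
    · exact one_le_two
    · simp
  obtain ⟨ε, hε, hε1, hε2, hε3⟩ : ∃ ε > 0, ε ≤ g ∧ ε ≤ R / 8 ∧
      320 * R ^ 2 * ε ≤ g / 2 ^ k * (η / 2) ^ 2 := by
    refine ⟨min g (min (R / 8) (g / 2 ^ k * (η / 2) ^ 2 / (320 * R ^ 2))), by positivity,
      min_le_left _ _, (min_le_right _ _).trans (min_le_left _ _), ?_⟩
    rw [mul_comm, ← le_div_iff₀ (by positivity)]
    exact (min_le_right _ _).trans (min_le_right _ _)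
  obtain ⟨z₁, hz₁, hz₁'⟩ := (infDist_lt_iff hne).1 (by linarith : infDist y E < g + ε)
  have hgz : g ≤ dist y z₁ := infDist_le_dist_of_mem hz₁
  obtain ⟨m, rfl, hm⟩ := hX.exists_isMidptSeq y z₁
  have hd := hm.dist_eq k
  have ha := hm.dist_add k
  have hym : 0 < dist y (m k) := by rw [hd]; exact div_pos (by linarith) (by positivity)
  have hzm : 0 < dist (m k) (m 0) := by
    have : dist y (m 0) / 2 ^ k < dist y (m 0) :=
      div_lt_self (by linarith) (one_lt_pow₀ one_lt_two hk1)
    linarith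
  have hi := infDist_le_infDist_add_dist (s := E) (x := y) (y := m k)
  have hi2 : infDist (m k) E ≤ dist (m k) (m 0) := infDist_le_dist_of_mem hz₁
  refine ⟨m k, ?_, Or.inr ⟨ε, hε, ?_⟩⟩
  · rw [mem_ball, dist_comm, hd]
    refine lt_of_le_of_lt ?_ hk
    gcongr
    linarith
  · have key : ∀ z ∈ E, dist (m k) z < infDist (m k) E + ε → dist z (m 0) ≤ η / 2 := by
      intro z hz hz'
      have hyz : g ≤ dist y z := infDist_le_dist_of_mem hz
      have h1 := hX.dist_le_of_almost_nearest h (z := z) hε.le ha (dist_pos.1 hym)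
        (dist_pos.1 hzm).symm (by linarith) hε2 (by linarith) (by linarith) (by linarith)
      have h2 : g / 2 ^ k ≤ dist y (m k) := by rw [hd]; gcongr
      have h3 : dist y (m k) * dist z (m 0) ^ 2 ≤ dist y (m k) * (η / 2) ^ 2 :=
        (h1.trans hε3).trans (by gcongr)
      exact le_of_sq_le_sq (le_of_mul_le_mul_left h3 hym) (by positivity)
    intro z hz z' hz' h1 h2
    linarith [dist_triangle_right z z' (m 0), key z hz h1, key z' hz' h2]

/-- Near a closed set, points having a nearest point in it are dense. -/
theorem IsAlexandrov.exists_dist_eq_infDist (hX : IsAlexandrov X κ) (h : IsSmallRadius κ R)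
    (hcl : IsClosed E) (hne : E.Nonempty) {y : X} (hy : infDist y E < R / 8) {ε : ℝ}
    (hε : 0 < ε) : ∃ y', dist y' y < ε ∧ ∃ z ∈ E, dist y' z = infDist y' E := by
  have := hX.1
  have hdense := dense_iInter_of_isOpen_nat
    (f := fun n : ℕ => {y | R / 8 < infDist y E} ∪ almostNearestSet E (1 / ((n : ℝ) + 1)))
    (fun n => (isOpen_lt continuous_const (continuous_infDist_pt E)).union
      (isOpen_almostNearestSet E _))
    (fun n => hX.dense_almostNearestSet h hne (by positivity))
  obtain ⟨y', hy', hmem⟩ := Metric.dense_iff.1 hdense y (min ε (R / 8 - infDist y E))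
    (lt_min hε (by linarith))
  rw [mem_ball, lt_min_iff] at hy'
  have hi := infDist_le_infDist_add_dist (s := E) (x := y') (y := y)
  have hV : ∀ n : ℕ, y' ∈ almostNearestSet E (1 / ((n : ℝ) + 1)) := fun n => by
    rcases mem_iInter.1 hmem n with h1 | h1
    · have h1 : R / 8 < infDist y' E := h1
      linarith
    · exact h1
  refine ⟨y', hy'.1, ?_⟩
  have hex : ∀ j : ℕ, ∃ z ∈ E, dist y' z < infDist y' E + 1 / ((j : ℝ) + 1) := fun j =>
    (infDist_lt_iff hne).1 (lt_add_of_pos_right _ (by positivity))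
  choose z hzE hz using hex
  have hc : CauchySeq z := by
    refine Metric.cauchySeq_iff'.2 fun e he => ?_
    obtain ⟨n, hn⟩ := exists_nat_one_div_lt he
    obtain ⟨ρ, hρ, hρ'⟩ := hV n
    obtain ⟨N, hN⟩ := exists_nat_one_div_lt hρ
    refine ⟨N, fun j hj => (hρ' _ (hzE j) _ (hzE N) ?_ ?_).trans_lt hn⟩
    · have : 1 / ((j : ℝ) + 1) ≤ 1 / ((N : ℝ) + 1) := by gcongr
      linarith [hz j]
    · linarith [hz N]
  obtain ⟨z₀, hz₀⟩ := cauchySeq_tendsto_of_complete hc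
  have hz₀E : z₀ ∈ E := hcl.mem_of_tendsto hz₀ (Eventually.of_forall hzE)
  refine ⟨z₀, hz₀E, le_antisymm ?_ (infDist_le_dist_of_mem hz₀E)⟩
  have l1 := (tendsto_const_nhds (x := y')).dist hz₀
  have l2 : Tendsto (fun j : ℕ => infDist y' E + 1 / ((j : ℝ) + 1)) atTop
      (𝓝 (infDist y' E + 0)) := tendsto_one_div_add_atTop_nhds_zero_nat.const_add _
  rw [add_zero] at l2
  exact le_of_tendsto_of_tendsto' l1 l2 fun j => (hz j).le

end Nearest

section Forward

variable {X : Type*} [MetricSpace X] {κ R : ℝ} {p x : X} {α : ℝ → X} {E : Set X}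

theorem eventually_slope_lt {f : ℝ → ℝ} {t c c' : ℝ} (hc : c < c')
    (h : ∀ᶠ s in 𝓝[>] 0, f (t + s) ≤ f t + c * s) : ∀ᶠ z in 𝓝[>] t, slope f t z < c' := by
  have hm : Tendsto (fun z => z - t) (𝓝[>] t) (𝓝[>] 0) := by
    refine tendsto_nhdsWithin_iff.2 ⟨?_, ?_⟩
    · have : Tendsto (fun z : ℝ => z - t) (𝓝 t) (𝓝 (t - t)) := tendsto_id.sub_const t
      rw [sub_self] at this
      exact this.mono_left nhdsWithin_le_nhds
    · filter_upwards [self_mem_nhdsWithin] with z hz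
      exact sub_pos.2 (mem_Ioi.1 hz)
  filter_upwards [hm.eventually h, self_mem_nhdsWithin] with z hz hzt
  have hzt : 0 < z - t := sub_pos.2 (mem_Ioi.1 hzt)
  rw [add_sub_cancel] at hz
  rw [slope_def_field, div_lt_iff₀ hzt]
  nlinarith

namespace IsGradCurve

/-- Integrated form of the first variation inequality along a gradient curve. -/
theorem dist_add_le (hα : IsGradCurve p x α) (hX : IsAlexandrov X κ) (h : IsSmallRadius κ R)
    (hpx : p ≠ x) {C r A : ℝ} {y₀ q : X} (hC : 0 ≤ C)
    (hf : MidConcaveOn (fun z => dist p z) C (ball y₀ r)) {t s : ℝ} (ht : 0 ≤ t) (hs : 0 ≤ s)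
    (hq : ∀ τ ∈ Ico t (t + s), α τ ≠ q ∧ dist (α τ) y₀ + dist (α τ) q < r ∧ dist (α τ) q < R ∧
      (dist p (α τ) - dist p q) / dist (α τ) q + 4 * C * dist (α τ) q ≤ A) :
    dist q (α (t + s)) ≤ dist q (α t) + A * s := by
  have hcont : ContinuousOn (fun τ => dist q (α τ)) (Icc t (t + s)) :=
    ((continuous_const.dist continuous_id).comp_continuousOn hα.2.1).mono fun τ hτ =>
      ht.trans hτ.1
  have hB : ∀ τ, HasDerivAt (fun τ => dist q (α t) + A * (τ - t)) A τ := fun τ => by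
    simpa using ((((hasDerivAt_id τ).sub_const t).const_mul A).const_add (dist q (α t)))
  have := image_le_of_liminf_slope_right_le_deriv_boundary hcont (B' := fun _ => A)
    (B := fun τ => dist q (α t) + A * (τ - t)) (by simp)
    (fun τ _ => (hB τ).continuousAt.continuousWithinAt) (fun τ _ => (hB τ).hasDerivWithinAt)
    (fun τ hτ c hc => ?_) (right_mem_Icc.2 (by linarith : t ≤ t + s))
  · simpa using this
  · obtain ⟨h1, h2, h3, h4⟩ := hq τ hτ
    have hε : 0 < (c - A) / 2 := by linarith
    refine (eventually_slope_lt (f := fun τ => dist q (α τ)) (c := A + (c - A) / 2)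
      (by linarith) ?_).frequently
    filter_upwards [hα.eventually_dist_le_add hX h hpx (ht.trans hτ.1) hC hf h1 h2 h3 hε,
      self_mem_nhdsWithin] with σ hσ hσ0
    have hσ0 : (0 : ℝ) < σ := hσ0
    refine hσ.trans (add_le_add_right (mul_le_mul_of_nonneg_right ?_ hσ0.le) _)
    have : (dist p q - dist p (α τ)) / dist (α τ) q =
        -((dist p (α τ) - dist p q) / dist (α τ) q) := by rw [← neg_div, neg_sub]
    linarith

/-- The distance to an extremal set grows at most linearly in itself along a gradient curve. -/
theorem eventually_infDist_le (hα : IsGradCurve p x α) (hX : IsAlexandrov X κ)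
    (h : IsSmallRadius κ R) (hpx : p ≠ x) {C C' r : ℝ} {y₀ : X} (hC : 0 ≤ C) (hC' : 0 ≤ C')
    (hf : MidConcaveOn (fun z => dist p z) C (ball y₀ r))
    (hcrit : ∀ z ∈ ball y₀ r, ∀ y ∈ ball y₀ r, y ≠ z → IsCriticalPt κ y z →
      dist p y ≤ dist p z + C' * dist y z ^ 2)
    (hE : IsExtremal κ E) (hne : E.Nonempty) {t c : ℝ} (ht : 0 ≤ t) (hg : 0 < infDist (α t) E)
    (hgR : infDist (α t) E < R / 8) (hgr : dist (α t) y₀ + infDist (α t) E < r)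
    (hc : (C' + 4 * C) * infDist (α t) E < c) :
    ∀ᶠ s in 𝓝[>] 0, infDist (α (t + s)) E ≤ infDist (α t) E + c * s := by
  set g := infDist (α t) E with hgdef
  have hlim : ∀ᶠ s : ℝ in 𝓝[>] 0,
      (C' * (g + s) ^ 2 + 2 * s) / (g - 3 * s) + 4 * C * (g + 3 * s) + 2 * s < c := by
    have : ContinuousAt (fun s : ℝ => (C' * (g + s) ^ 2 + 2 * s) / (g - 3 * s) +
        4 * C * (g + 3 * s) + 2 * s) 0 := by
      refine ((ContinuousAt.div (by fun_prop) (by fun_prop) ?_).add (by fun_prop)).add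
        (by fun_prop)
      simpa using hg.ne'
    refine nhdsWithin_le_nhds (this.eventually_lt continuousAt_const ?_)
    have : C' * g ^ 2 / g = C' * g := by field_simp
    simp only [add_zero, mul_zero, sub_zero, this]
    linarith
  filter_upwards [hlim, eventually_mul_lt 1 one_pos, eventually_mul_lt 4 hg,
    eventually_mul_lt 5 (sub_pos.2 hgr), eventually_mul_lt 3 (sub_pos.2 hgR),
    self_mem_nhdsWithin] with s hlim hs1 hsg hsr hsR hs0
  have hs0 : (0 : ℝ) < s := hs0
  have hss : s ^ 2 ≤ s := by nlinarith
  have hs2 : 0 < s ^ 2 := by positivity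
  obtain ⟨y, hy, z, hzE, hz⟩ := hX.exists_dist_eq_infDist h hE.1 hne hgR hs2
  have hi1 : infDist y E ≤ g + dist y (α t) := infDist_le_infDist_add_dist
  have hi2 : g ≤ infDist (y) E + dist (α t) y := infDist_le_infDist_add_dist
  rw [dist_comm (α t) y] at hi2
  have hpos : 0 < infDist y E := by linarith
  have hyE : y ∉ E := fun hmem => hpos.ne' (infDist_zero_of_mem hmem)
  have hyz : y ≠ z := fun e => hyE (e ▸ hzE)
  have hcr : IsCriticalPt κ y z := by
    refine hE.2 y hyE z hzE (Eventually.filter_mono inf_le_right ?_)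
    exact eventually_principal.2 fun w hw => hz.trans_le (infDist_le_dist_of_mem hw)
  have hyb : y ∈ ball y₀ r := by
    rw [mem_ball]
    linarith [dist_triangle y (α t) y₀]
  have hzb : z ∈ ball y₀ r := by
    rw [mem_ball]
    linarith [dist_triangle y (α t) y₀, dist_triangle_left z y₀ y]
  have hfz := hcrit z hzb y hyb hyz hcr
  have hstep := hα.dist_add_le hX h hpx (q := z)
    (A := (C' * (g + s) ^ 2 + 2 * s) / (g - 3 * s) + 4 * C * (g + 3 * s)) hC hf ht hs0.le ?_
  · have h1 : infDist (α (t + s)) E ≤ dist (α (t + s)) z := infDist_le_dist_of_mem hzE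
    rw [dist_comm] at h1
    have h2 := dist_triangle_left z (α t) y
    nlinarith
  · intro τ hτ
    have hτ1 := hα.dist_le hX hpx ht hτ.1
    have hτ2 : dist (α τ) y ≤ 2 * s := by
      linarith [dist_triangle_left (α τ) y (α t), hτ.2, dist_comm y (α t)]
    have hD1 : dist (α τ) z ≤ g + 3 * s := by linarith [dist_triangle (α τ) y z]
    have hD2 : g - 3 * s ≤ dist (α τ) z := by linarith [dist_triangle_left y z (α τ)]
    have hD0 : 0 < g - 3 * s := by linarith
    have hp : dist p (α τ) - dist p z ≤ C' * (g + s) ^ 2 + 2 * s := by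
      have : C' * dist y z ^ 2 ≤ C' * (g + s) ^ 2 := by
        gcongr
        linarith
      linarith [dist_triangle_right p (α τ) y]
    refine ⟨dist_pos.1 (hD0.trans_le hD2), ?_, by linarith, ?_⟩
    · linarith [dist_triangle_left (α τ) y₀ (α t), hτ.2]
    · gcongr

/-- Extremal sets are invariant under gradient curves of distance functions. -/
theorem mem_of_isExtremal (hα : IsGradCurve p x α) (hX : IsAlexandrov X κ) (hpx : p ≠ x)
    (hE : IsExtremal κ E) (hx : x ∈ E) {T : ℝ} (hT : 0 ≤ T) : α T ∈ E := by
  by_contra hTE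
  have hne : E.Nonempty := ⟨x, hx⟩
  set S := {t | t ∈ Icc 0 T ∧ α (max t 0) ∈ E} with hS
  have hScl : IsClosed S := isClosed_Icc.inter (hE.1.preimage hα.continuous_extend)
  have hSne : S.Nonempty := ⟨0, ⟨le_rfl, hT⟩, by simpa [hα.1] using hx⟩
  have hSb : BddAbove S := ⟨T, fun t ht => ht.1.2⟩
  obtain ⟨⟨h0, h0T⟩, hmem⟩ := hScl.csSup_mem hSne hSb
  set t₀ := sSup S
  rw [max_eq_left h0] at hmem
  have hlt : t₀ < T := h0T.lt_of_ne fun e => hTE (e ▸ hmem)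
  have hnot : ∀ t ∈ Ioc t₀ T, α t ∉ E := fun t ht hmt =>
    (le_csSup hSb ⟨⟨h0.trans ht.1.le, ht.2⟩, by
      rwa [max_eq_left (h0.trans ht.1.le)]⟩).not_gt ht.1
  have hp₀ : p ≠ α t₀ := hα.ne hpx h0
  obtain ⟨C, hC, r₁, hr₁, hf⟩ := hX.exists_midConcaveOn hp₀
  obtain ⟨C', hC', r₂, hr₂, hcrit⟩ := hX.dist_le_of_isCriticalPt hp₀
  obtain ⟨R, hR⟩ := exists_isSmallRadius κ
  obtain ⟨r, hr, hr1, hr2⟩ : ∃ r > 0, r ≤ r₁ ∧ r ≤ r₂ :=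
    ⟨min r₁ r₂, lt_min hr₁ hr₂, min_le_left _ _, min_le_right _ _⟩
  have hR0 := hR.1
  obtain ⟨b, hb, hbT, hbr, hbR⟩ : ∃ b > t₀, b ≤ T ∧ b - t₀ < r / 2 ∧ b - t₀ < R / 8 := by
    refine ⟨t₀ + min (T - t₀) (min (r / 4) (R / 16)), ?_, ?_, ?_, ?_⟩
    · exact lt_add_of_pos_right _ (lt_min (by linarith) (lt_min (by linarith) (by linarith)))
    · linarith [min_le_left (T - t₀) (min (r / 4) (R / 16))]
    · have h1 := min_le_right (T - t₀) (min (r / 4) (R / 16))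
      have h2 := min_le_left (r / 4) (R / 16)
      linarith
    · have h1 := min_le_right (T - t₀) (min (r / 4) (R / 16))
      have h2 := min_le_right (r / 4) (R / 16)
      linarith
  have hd : ∀ t, t₀ ≤ t → dist (α t) (α t₀) ≤ t - t₀ := fun t ht => by
    rw [dist_comm]
    exact hα.dist_le hX hpx h0 ht
  have hi : ∀ t, t₀ ≤ t → infDist (α t) E ≤ t - t₀ := fun t ht =>
    (infDist_le_dist_of_mem hmem).trans (hd t ht)
  have hgr : ∀ a ∈ Ioc t₀ b, infDist (α b) E ≤
      infDist (α a) E * exp ((C' + 4 * C) * (b - a)) := by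
    intro a ha
    have hcont : ContinuousOn (fun t => infDist (α t) E) (Icc a b) :=
      ((continuous_infDist_pt E).comp_continuousOn hα.2.1).mono fun t ht =>
        h0.trans (ha.1.le.trans ht.1)
    have := le_gronwallBound_of_liminf_deriv_right_le hcont
      (f' := fun t => (C' + 4 * C) * infDist (α t) E) (K := C' + 4 * C) (ε := 0)
      (fun t ht c hc => ?_) le_rfl (fun t _ => by simp) b (right_mem_Icc.2 ha.2)
    · rwa [gronwallBound_ε0] at this
    · have ht0 : t₀ < t := ha.1.trans_le ht.1
      have hpos : 0 < infDist (α t) E :=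
        (hE.1.notMem_iff_infDist_pos hne).1 (hnot t ⟨ht0, ht.2.le.trans hbT⟩)
      obtain ⟨c', hc', hcc⟩ := exists_between hc
      have h1 := hd t ht0.le
      have h2 := hi t ht0.le
      have h3 := ht.2
      have hev := hα.eventually_infDist_le hX hR hpx (y₀ := α t₀) hC hC'
        (fun a ha b hb => hf a (ball_subset_ball hr1 ha) b (ball_subset_ball hr1 hb))
        (fun z hz y hy => hcrit z (ball_subset_ball hr2 hz) y (ball_subset_ball hr2 hy))
        hE hne (h0.trans ht0.le) hpos (by linarith) (by linarith) hc'
      have := eventually_slope_lt (f := fun t => infDist (α t) E) hcc hev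
      simpa only [slope_def_module, smul_eq_mul] using this.frequently
  have hpos : 0 < infDist (α b) E :=
    (hE.1.notMem_iff_infDist_pos hne).1 (hnot b ⟨hb, hbT⟩)
  have hlim : Tendsto (fun a => (a - t₀) * exp ((C' + 4 * C) * (b - t₀))) (𝓝[>] t₀) (𝓝 0) := by
    have : Continuous fun a => (a - t₀) * exp ((C' + 4 * C) * (b - t₀)) := by fun_prop
    simpa using (this.tendsto t₀).mono_left nhdsWithin_le_nhds
  refine hpos.not_ge (ge_of_tendsto hlim ?_)
  filter_upwards [Ioc_mem_nhdsGT hb] with a ha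
  refine (hgr a ha).trans (mul_le_mul (hi a ha.1.le) (exp_le_exp.2 ?_) (exp_pos _).le
    (sub_nonneg.2 ha.1.le))
  gcongr
  exact ha.1.le

end IsGradCurve

end Forward

end GradientInvariance

/-- a closed subset of an Alexandrov space is extremal iff it is
invariant under the gradient curves of all distance functions. -/
theorem stmt18 {X : Type*} [MetricSpace X] (κ : ℝ) (hX : IsAlexandrov X κ)
    (n : ℕ) (hdim : dimH (Set.univ : Set X) = n)
    (gc : X → X → ℝ → X)
    (hgc : ∀ p x : X, p ≠ x → IsGradCurve p x (gc p x))
    (huniq : ∀ (p x : X) (α : ℝ → X), p ≠ x → IsGradCurve p x α →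
      ∀ t ≥ (0:ℝ), α t = gc p x t)
    (E : Set X) (hcl : IsClosed E) :
    IsExtremal κ E ↔ ∀ p x : X, x ∈ E → p ≠ x → ∀ t ≥ (0:ℝ), gc p x t ∈ E := by
  exact ⟨fun hE p x hx hpx t ht => (hgc p x hpx).mem_of_isExtremal hX hpx hE hx ht,
    fun h => hX.isExtremal_of_forall_mem hgc hcl h⟩
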